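/- arXiv:1910.06839 — 2 statements merged into one kernel-verified Lean document; each statement's English description precedes it below -/
import Mathlib

section
/- Let 0 ≤ α < n, Q_0 ⊂ ℝ^n a cube, and σ ∈ A_∞^d(Q_0) with constants C_σ, δ_σ > 0. For every f ∈ L^1(Q_0) there is a collection S ⊂ D(Q_0) of dyadic cubes satisfying: (a) there are a constant η = η(C_σ, δ_σ) > 0 and pairwise disjoint measurable sets E_Q ⊂ Q for Q ∈ S with σ(E_Q) ≥ η σ(Q); and (b) for almost every x ∈ Q_0 and every 1 ≤ p < ∞, (M^d_{α,Q_0} f(x))^p ≤ C Σ_{Q∈S} χ_Q(x) (|Q|^{α/n − 1}∫_Q |f(y)| dy)^p, with C = C(n, p, C_σ, δ_σ) > 0. -/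
open MeasureTheory ENNReal NNReal Set

noncomputable section

/-- Euclidean space `ℝ^n`. -/
abbrev Rn (n : ℕ) := EuclideanSpace ℝ (Fin n)

/-- The half-open cube with lower corner `a` and side length `l`:
`Q = [a₁, a₁+l) × … × [aₙ, aₙ+l)`. -/
def Cube {n : ℕ} (a : Rn n) (l : ℝ) : Set (Rn n) :=
  {x | ∀ i, a i ≤ x i ∧ x i < a i + l}

/-- `IsDyadicSub a l Q` : `Q` belongs to the collection `D(Q₀)` of dyadic subcubes of the cube
`Q₀ = Cube a l`, i.e. `Q₀` together with all cubes obtained from `Q₀` by recursively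
bisecting each edge. -/
def IsDyadicSub {n : ℕ} (a : Rn n) (l : ℝ) (Q : Set (Rn n)) : Prop :=
  ∃ (k : ℕ) (m : Fin n → ℕ), (∀ i, m i < 2 ^ k) ∧
    Q = {x : Rn n | ∀ i, a i + l * m i / 2 ^ k ≤ x i ∧ x i < a i + l * m i / 2 ^ k + l / 2 ^ k}

/-- The weighted measure `w(E) = ∫_E w dx` of a set, as an extended nonnegative real. -/
def wMass {n : ℕ} (w : Rn n → ℝ) (E : Set (Rn n)) : ℝ≥0∞ :=
  ∫⁻ x in E, ENNReal.ofReal (w x)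

/-- The dyadic Muckenhoupt `A_∞` condition on `Q₀ = Cube a l` with constants `Cσ, δσ`. -/
def IsAinftyD {n : ℕ} (a : Rn n) (l : ℝ) (σ : Rn n → ℝ) (Cσ δσ : ℝ) : Prop :=
  ∀ Q : Set (Rn n), IsDyadicSub a l Q → ∀ E : Set (Rn n), MeasurableSet E → E ⊆ Q →
    wMass σ E ≤ ENNReal.ofReal Cσ * (volume E / volume Q) ^ δσ * wMass σ Q

/-- The dyadic fractional maximal function
`M^d_{α,Q₀} f(x) = sup_{Q ∋ x, Q ∈ D(Q₀)} |Q|^{α/n−1} ∫_Q |f|`, where `Q₀ = Cube a l`. -/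
def MaxFrac {n : ℕ} (α : ℝ) (a : Rn n) (l : ℝ) (f : Rn n → ℝ) (x : Rn n) : ℝ≥0∞ :=
  ⨆ (Q : Set (Rn n)) (_ : IsDyadicSub a l Q) (_ : x ∈ Q),
    volume Q ^ (α / n - 1) * ∫⁻ y in Q, ENNReal.ofReal |f y|

/-- On a well-founded relation every constraint `P` has a greedy set: `x` is selected exactly when
`P y x` holds for all selected predecessors `y`. -/
lemma exists_greedy_set {I : Type*} {r : I → I → Prop} (hr : WellFounded r) (P : I → I → Prop) :
    ∃ S : Set I, ∀ x, x ∈ S ↔ ∀ y, r y x → y ∈ S → P y x := by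
  refine ⟨{x | hr.fix (C := fun _ => Prop) (fun x ih => ∀ y (h : r y x), ih y h → P y x) x},
    fun x => ?_⟩
  rw [Set.mem_ofPred_eq, hr.fix_eq]
  rfl

section Dyadic

variable {n : ℕ} {a : Rn n} {l : ℝ} {Q R : Set (Rn n)}

/-- The dyadic cube of generation `k` and position `m` inside `Cube a l`. -/
def dyadicCube (a : Rn n) (l : ℝ) (k : ℕ) (m : Fin n → ℕ) : Set (Rn n) :=
  {x : Rn n | ∀ i, a i + l * m i / 2 ^ k ≤ x i ∧ x i < a i + l * m i / 2 ^ k + l / 2 ^ k}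

lemma dyadicCube_eq_preimage (k : ℕ) (m : Fin n → ℕ) :
    dyadicCube a l k m = (WithLp.ofLp : Rn n → (Fin n → ℝ)) ⁻¹'
      Set.pi univ (fun i => Ico (a i + l * m i / 2 ^ k) (a i + l * m i / 2 ^ k + l / 2 ^ k)) := by
  ext x
  simp [dyadicCube]

lemma measurableSet_pi_Ico (u v : Fin n → ℝ) :
    MeasurableSet (Set.pi univ (fun i => Ico (u i) (v i))) :=
  MeasurableSet.univ_pi fun _ => measurableSet_Ico

lemma measurableSet_dyadicCube (k : ℕ) (m : Fin n → ℕ) : MeasurableSet (dyadicCube a l k m) := by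
  rw [dyadicCube_eq_preimage]
  exact (PiLp.volume_preserving_ofLp (Fin n)).measurable (measurableSet_pi_Ico _ _)

lemma volume_dyadicCube (k : ℕ) (m : Fin n → ℕ) :
    volume (dyadicCube a l k m) = ENNReal.ofReal (l / 2 ^ k) ^ n := by
  rw [dyadicCube_eq_preimage, (PiLp.volume_preserving_ofLp (Fin n)).measure_preimage
    (measurableSet_pi_Ico _ _).nullMeasurableSet, volume_pi_pi]
  simp

/-- A cube meeting a cube of an earlier generation is contained in it. -/
lemma dyadicCube_subset_of_inter (hl : 0 < l) {k k' : ℕ} (hk : k ≤ k') {m m' : Fin n → ℕ}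
    {x : Rn n} (hx : x ∈ dyadicCube a l k m) (hx' : x ∈ dyadicCube a l k' m') :
    dyadicCube a l k' m' ⊆ dyadicCube a l k m := by
  obtain ⟨d, rfl⟩ := Nat.exists_eq_add_of_le hk
  intro y hy i
  obtain ⟨h1, h2⟩ := hx i
  obtain ⟨h3, h4⟩ := hx' i
  obtain ⟨h5, h6⟩ := hy i
  set s : ℝ := l / 2 ^ (k + d) with hs
  have hs0 : 0 < s := by positivity
  have e1 : l * m i / 2 ^ k = s * ((m i * 2 ^ d : ℕ) : ℝ) := by
    rw [hs]; push_cast; field_simp; ring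
  have e2 : l / 2 ^ k = s * ((2 ^ d : ℕ) : ℝ) := by
    rw [hs]; push_cast; field_simp; ring
  have e3 : l * m' i / 2 ^ (k + d) = s * (m' i : ℝ) := by
    rw [hs]; ring
  rw [e1] at h1
  rw [e1, e2] at h2
  rw [e3] at h3 h4 h5 h6
  rw [e1, e2]
  have lo : m i * 2 ^ d < m' i + 1 := by
    have : s * ((m i * 2 ^ d : ℕ) : ℝ) < s * ((m' i + 1 : ℕ) : ℝ) := by
      push_cast at h1 ⊢; linarith
    exact_mod_cast lt_of_mul_lt_mul_left this hs0.le
  have hi : m' i < m i * 2 ^ d + 2 ^ d := by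
    have : s * (m' i : ℝ) < s * ((m i * 2 ^ d + 2 ^ d : ℕ) : ℝ) := by
      push_cast at h2 ⊢; linarith
    exact_mod_cast lt_of_mul_lt_mul_left this hs0.le
  have lo' : s * ((m i * 2 ^ d : ℕ) : ℝ) ≤ s * (m' i : ℝ) :=
    mul_le_mul_of_nonneg_left (by exact_mod_cast Nat.lt_succ_iff.mp lo) hs0.le
  have hi' : s * ((m' i + 1 : ℕ) : ℝ) ≤ s * ((m i * 2 ^ d + 2 ^ d : ℕ) : ℝ) :=
    mul_le_mul_of_nonneg_left (by exact_mod_cast hi) hs0.le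
  push_cast at lo' hi' ⊢
  constructor <;> linarith

lemma dyadicCube_nonempty (hl : 0 < l) (k : ℕ) (m : Fin n → ℕ) :
    (dyadicCube a l k m).Nonempty := by
  refine ⟨WithLp.toLp 2 (fun i => a i + l * m i / 2 ^ k), fun i => ⟨le_rfl, ?_⟩⟩
  have : 0 < l / 2 ^ k := by positivity
  simpa using this

namespace IsDyadicSub

lemma measurableSet (h : IsDyadicSub a l Q) : MeasurableSet Q := by
  obtain ⟨k, m, -, rfl⟩ := h
  exact measurableSet_dyadicCube k m

lemma volume_ne_zero (hl : 0 < l) (h : IsDyadicSub a l Q) : volume Q ≠ 0 := by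
  obtain ⟨k, m, -, rfl⟩ := h
  have : volume (dyadicCube a l k m) ≠ 0 := by
    rw [volume_dyadicCube]
    exact pow_ne_zero _ (ENNReal.ofReal_pos.mpr (by positivity)).ne'
  exact this

lemma volume_ne_top (h : IsDyadicSub a l Q) : volume Q ≠ ∞ := by
  obtain ⟨k, m, -, rfl⟩ := h
  have : volume (dyadicCube a l k m) ≠ ∞ := by
    rw [volume_dyadicCube]
    exact ENNReal.pow_ne_top ENNReal.ofReal_ne_top
  exact this

lemma nonempty (hl : 0 < l) (h : IsDyadicSub a l Q) : Q.Nonempty := by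
  obtain ⟨k, m, -, rfl⟩ := h
  exact dyadicCube_nonempty hl k m

lemma subset_cube (hl : 0 < l) (h : IsDyadicSub a l Q) : Q ⊆ Cube a l := by
  obtain ⟨k, m, hm, rfl⟩ := h
  intro x hx i
  obtain ⟨h1, h2⟩ := hx i
  have h0 : 0 ≤ l * m i / 2 ^ k := by positivity
  have hle : l * m i / 2 ^ k + l / 2 ^ k ≤ l := by
    rw [← add_div, div_le_iff₀ (by positivity)]
    have : ((m i + 1 : ℕ) : ℝ) ≤ ((2 ^ k : ℕ) : ℝ) := by exact_mod_cast hm i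
    push_cast at this
    nlinarith
  constructor <;> linarith

lemma disjoint_or_subset (hl : 0 < l) (hQ : IsDyadicSub a l Q) (hR : IsDyadicSub a l R) :
    Disjoint Q R ∨ Q ⊆ R ∨ R ⊆ Q := by
  rw [or_iff_not_imp_left, Set.not_disjoint_iff]
  rintro ⟨x, hxQ, hxR⟩
  obtain ⟨k, m, -, rfl⟩ := hQ
  obtain ⟨k', m', -, rfl⟩ := hR
  rcases le_total k k' with h | h
  · exact Or.inr (dyadicCube_subset_of_inter hl h hxQ hxR)
  · exact Or.inl (dyadicCube_subset_of_inter hl h hxR hxQ)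

/-- A dyadic cube has only finitely many dyadic ancestors. -/
lemma wellFounded_ssuperset (hl : 0 < l) :
    WellFounded (fun R Q : {Q : Set (Rn n) // IsDyadicSub a l Q} => Q.1 ⊂ R.1) := by
  refine Subrelation.wf (r := InvImage (· < ·)
    (fun Q : {Q : Set (Rn n) // IsDyadicSub a l Q} => Q.2.choose)) ?_ (InvImage.wf _ wellFounded_lt)
  intro R Q hQR
  by_contra hlt
  have hle : Q.2.choose ≤ R.2.choose := not_lt.mp hlt
  obtain ⟨m, -, hQ⟩ := Q.2.choose_spec
  obtain ⟨m', -, hR⟩ := R.2.choose_spec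
  obtain ⟨x, hx⟩ := Q.2.nonempty hl
  have hxR := hQR.1 hx
  have : R.1 ⊆ Q.1 := by
    rw [hQ] at hx
    rw [hR] at hxR
    rw [hQ, hR]
    exact dyadicCube_subset_of_inter hl hle hx hxR
  exact hQR.2 this

end IsDyadicSub

lemma countable_setOf_isDyadicSub : {Q : Set (Rn n) | IsDyadicSub a l Q}.Countable := by
  refine (Set.countable_range (fun q : ℕ × (Fin n → ℕ) => dyadicCube a l q.1 q.2)).mono ?_
  rintro Q ⟨k, m, -, rfl⟩
  exact ⟨(k, m), rfl⟩

/-- Every family of dyadic cubes contains a disjoint subfamily (its maximal cubes) with the same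
union. -/
lemma exists_disjoint_subfamily (hl : 0 < l) {T : Set (Set (Rn n))}
    (hT : ∀ Q ∈ T, IsDyadicSub a l Q) :
    ∃ T' ⊆ T, T'.PairwiseDisjoint id ∧ ⋃₀ T = ⋃₀ T' := by
  refine ⟨{Q | Q ∈ T ∧ ∀ R ∈ T, ¬ Q ⊂ R}, fun Q hQ => hQ.1, ?_, ?_⟩
  · intro Q hQ R hR hne
    rcases (hT Q hQ.1).disjoint_or_subset hl (hT R hR.1) with h | h | h
    · exact h
    · exact absurd (h.ssubset_of_ne hne) (hQ.2 R hR.1)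
    · exact absurd (h.ssubset_of_ne hne.symm) (hR.2 Q hQ.1)
  · refine Subset.antisymm ?_ (sUnion_subset_sUnion fun Q hQ => hQ.1)
    rintro x ⟨Q, hQ, hx⟩
    obtain ⟨R, ⟨hRT, hxR⟩, hmin⟩ := (IsDyadicSub.wellFounded_ssuperset hl).has_min
      {R : {Q : Set (Rn n) // IsDyadicSub a l Q} | R.1 ∈ T ∧ x ∈ R.1} ⟨⟨Q, hT Q hQ⟩, hQ, hx⟩
    exact ⟨R.1, ⟨hRT, fun R' hR' hss => hmin ⟨R', hT R' hR'⟩ ⟨hR', hss.1 hxR⟩ hss⟩, hxR⟩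

/-- The fractional average `|Q|^{α/n−1} ∫_Q |f|`. -/
def fracAvg (α : ℝ) (f : Rn n → ℝ) (Q : Set (Rn n)) : ℝ≥0∞ :=
  volume Q ^ (α / n - 1) * ∫⁻ y in Q, ENNReal.ofReal |f y|

lemma fracAvg_mul_volume (hl : 0 < l) (α : ℝ) (f : Rn n → ℝ) (hQ : IsDyadicSub a l Q) :
    fracAvg α f Q * volume Q = volume Q ^ (α / n) * ∫⁻ y in Q, ENNReal.ofReal |f y| := by
  rw [fracAvg, mul_right_comm]
  congr 1
  conv_lhs => enter [2]; rw [← ENNReal.rpow_one (volume Q)]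
  rw [← ENNReal.rpow_add _ _ (hQ.volume_ne_zero hl) hQ.volume_ne_top, sub_add_cancel]

/-- The subcubes of `Q` whose fractional average exceeds `c` times that of `Q` occupy at most a
`1 / c` proportion of `Q`. -/
lemma volume_sUnion_le (hl : 0 < l) {α : ℝ} (hα : 0 ≤ α) (f : Rn n → ℝ) {c : ℝ≥0∞}
    (hQ : IsDyadicSub a l Q) {T : Set (Set (Rn n))}
    (hT : ∀ R ∈ T, IsDyadicSub a l R ∧ R ⊆ Q ∧ c * fracAvg α f Q < fracAvg α f R) :
    c * volume (⋃₀ T) ≤ volume Q := by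
  rcases T.eq_empty_or_nonempty with rfl | ⟨R₀, hR₀⟩
  · simp
  rcases eq_or_ne c 0 with rfl | hc
  · simp
  have hαn : 0 ≤ α / n := by positivity
  have hAtop : fracAvg α f Q ≠ ∞ := by
    intro h
    have := (hT R₀ hR₀).2.2
    rw [h, ENNReal.mul_top hc] at this
    exact not_top_lt this
  have hA0 : fracAvg α f Q ≠ 0 := by
    intro h
    obtain ⟨-, hsub, hlt⟩ := hT R₀ hR₀
    have hint : ∫⁻ y in Q, ENNReal.ofReal |f y| = 0 := by
      have := fracAvg_mul_volume hl α f hQ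
      rw [h, zero_mul, eq_comm, mul_eq_zero] at this
      refine this.resolve_left ?_
      exact (ENNReal.rpow_pos (pos_iff_ne_zero.mpr (hQ.volume_ne_zero hl)) hQ.volume_ne_top).ne'
    have hint' : ∫⁻ y in R₀, ENNReal.ofReal |f y| = 0 :=
      le_antisymm (hint ▸ lintegral_mono_set hsub) bot_le
    simp [fracAvg, hint'] at hlt
  obtain ⟨T', hT'T, hdisj, hU⟩ := exists_disjoint_subfamily hl fun R hR => (hT R hR).1
  have hcount : T'.Countable :=
    countable_setOf_isDyadicSub.mono fun R hR => (hT R (hT'T hR)).1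
  have hmeas : ∀ R ∈ T', MeasurableSet R := fun R hR => (hT R (hT'T hR)).1.measurableSet
  have key : fracAvg α f Q * (c * volume (⋃₀ T)) ≤ fracAvg α f Q * volume Q := by
    calc fracAvg α f Q * (c * volume (⋃₀ T))
        = ∑' R : T', c * fracAvg α f Q * volume (R : Set (Rn n)) := by
          rw [hU, measure_sUnion hcount hdisj hmeas, ENNReal.tsum_mul_left]
          ring
      _ ≤ ∑' R : T', volume Q ^ (α / n) * ∫⁻ y in (R : Set (Rn n)), ENNReal.ofReal |f y| := by
          refine ENNReal.tsum_le_tsum fun R => ?_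
          obtain ⟨hR, hsub, hlt⟩ := hT R (hT'T R.2)
          calc c * fracAvg α f Q * volume (R : Set (Rn n))
              ≤ fracAvg α f R * volume (R : Set (Rn n)) := by gcongr
            _ = volume (R : Set (Rn n)) ^ (α / n) *
                  ∫⁻ y in (R : Set (Rn n)), ENNReal.ofReal |f y| := fracAvg_mul_volume hl α f hR
            _ ≤ _ := by gcongr
      _ = volume Q ^ (α / n) * ∫⁻ y in ⋃₀ T', ENNReal.ofReal |f y| := by
          rw [ENNReal.tsum_mul_left, sUnion_eq_biUnion, lintegral_biUnion hcount hmeas hdisj]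
      _ ≤ volume Q ^ (α / n) * ∫⁻ y in Q, ENNReal.ofReal |f y| := by
          gcongr
          exact sUnion_subset fun R hR => (hT R (hT'T hR)).2.1
      _ = fracAvg α f Q * volume Q := (fracAvg_mul_volume hl α f hQ).symm
  exact (ENNReal.mul_le_mul_iff_right hA0 hAtop).mp key

/-- The `A_∞` condition turns a small Lebesgue proportion into at most half the weighted mass. -/
lemma half_wMass_le_diff {σ : Rn n → ℝ} {Cσ δσ c : ℝ} (hl : 0 < l) (hCσ : 0 < Cσ) (hδσ : 0 < δσ)
    (hc : 0 < c) (hcC : 2 * Cσ ≤ c ^ δσ) (hσ : IntegrableOn σ (Cube a l) volume)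
    (hA : IsAinftyD a l σ Cσ δσ) (hQ : IsDyadicSub a l Q) {U : Set (Rn n)}
    (hU : MeasurableSet U) (hUQ : U ⊆ Q) (hvol : ENNReal.ofReal c * volume U ≤ volume Q) :
    ENNReal.ofReal (1 / 2) * wMass σ Q ≤ wMass σ (Q \ U) := by
  have hfin : wMass σ Q ≠ ∞ :=
    ((lintegral_mono_set (hQ.subset_cube hl)).trans_lt hσ.lintegral_lt_top).ne
  have hratio : volume U / volume Q ≤ ENNReal.ofReal c⁻¹ := by
    rw [ENNReal.ofReal_inv_of_pos hc]
    refine ENNReal.div_le_of_le_mul ?_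
    rw [mul_comm, ← div_eq_mul_inv, ENNReal.le_div_iff_mul_le (Or.inl (by simpa using hc))
      (Or.inl ENNReal.ofReal_ne_top), mul_comm]
    exact hvol
  have hsmall : wMass σ U ≤ ENNReal.ofReal (1 / 2) * wMass σ Q := by
    refine (hA Q hQ U hU hUQ).trans ?_
    gcongr
    calc ENNReal.ofReal Cσ * (volume U / volume Q) ^ δσ
        ≤ ENNReal.ofReal Cσ * ENNReal.ofReal c⁻¹ ^ δσ := by gcongr
      _ = ENNReal.ofReal (Cσ * (c ^ δσ)⁻¹) := by
          rw [ENNReal.ofReal_rpow_of_pos (by positivity), ← ENNReal.ofReal_mul hCσ.le,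
            Real.inv_rpow hc.le]
      _ ≤ ENNReal.ofReal (1 / 2) := by
          apply ENNReal.ofReal_le_ofReal
          rw [← div_eq_mul_inv, div_le_iff₀ (by positivity)]
          linarith
  have hsplit : wMass σ Q ≤ wMass σ U + wMass σ (Q \ U) := by
    calc wMass σ Q = wMass σ (U ∪ Q \ U) := by rw [union_sdiff_cancel hUQ]
      _ ≤ _ := lintegral_union_le _ _ _
  have hhalf : wMass σ Q =
      ENNReal.ofReal (1 / 2) * wMass σ Q + ENNReal.ofReal (1 / 2) * wMass σ Q := by
    rw [← add_mul, ← ENNReal.ofReal_add (by norm_num) (by norm_num)]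
    norm_num
  have hfin' : ENNReal.ofReal (1 / 2) * wMass σ Q ≠ ∞ := ENNReal.mul_ne_top ofReal_ne_top hfin
  refine (ENNReal.add_le_add_iff_left hfin').mp ?_
  rw [← hhalf]
  exact hsplit.trans (by gcongr)

end Dyadic

/-- sparse domination for the dyadic fractional maximal function, after
Pérez: for `0 ≤ α < n`, `σ ∈ A_∞^d(Q₀)` with constants `Cσ, δσ` and `f ∈ L¹(Q₀)`, there is a
collection `𝒮` of dyadic cubes which is `η(Cσ, δσ)`-sparse with respect to `σ`, such that for
a.e. `x ∈ Q₀` and every `1 ≤ p < ∞`,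
`(M^d_{α,Q₀} f(x))^p ≤ C(p) Σ_{Q∈𝒮} χ_Q(x) (|Q|^{α/n−1} ∫_Q |f|)^p`, where
`C(p) = C(n, p, Cσ, δσ) > 0`. -/
theorem sparse_domination_fractional_maximal
    (Cσ δσ : ℝ) (hCσ : 0 < Cσ) (hδσ : 0 < δσ) :
    ∃ η : ℝ, 0 < η ∧ ∀ (n : ℕ) (α : ℝ), 0 ≤ α → α < n →
      ∃ C : ℝ → ℝ, (∀ p : ℝ, 1 ≤ p → 0 < C p) ∧
      ∀ (a : Rn n) (l : ℝ), 0 < l →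
      ∀ σ : Rn n → ℝ, IntegrableOn σ (Cube a l) volume →
        (∀ᵐ x ∂(volume : Measure (Rn n)), x ∈ Cube a l → 0 < σ x) →
        IsAinftyD a l σ Cσ δσ →
      ∀ f : Rn n → ℝ, IntegrableOn f (Cube a l) volume →
      ∃ 𝒮 : Set (Set (Rn n)),
        (∀ S ∈ 𝒮, IsDyadicSub a l S) ∧
        (∃ E : Set (Rn n) → Set (Rn n),
          (∀ Q ∈ 𝒮, MeasurableSet (E Q) ∧ E Q ⊆ Q ∧
            ENNReal.ofReal η * wMass σ Q ≤ wMass σ (E Q)) ∧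
          𝒮.PairwiseDisjoint E) ∧
        (∀ p : ℝ, 1 ≤ p →
          ∀ᵐ x ∂(volume : Measure (Rn n)), x ∈ Cube a l →
            (MaxFrac α a l f x) ^ p ≤
              ENNReal.ofReal (C p) *
                ∑' Q : 𝒮, Set.indicator (Q : Set (Rn n))
                  (fun _ => (volume (Q : Set (Rn n)) ^ (α / n - 1) *
                    ∫⁻ y in (Q : Set (Rn n)), ENNReal.ofReal |f y|) ^ p) x) := by
  set c : ℝ := max 1 ((2 * Cσ) ^ δσ⁻¹)
  have hc1 : 1 ≤ c := le_max_left _ _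
  have hc0 : 0 < c := zero_lt_one.trans_le hc1
  have hcC : 2 * Cσ ≤ c ^ δσ := by
    calc 2 * Cσ = ((2 * Cσ) ^ δσ⁻¹) ^ δσ := (Real.rpow_inv_rpow (by positivity) hδσ.ne').symm
      _ ≤ c ^ δσ := by
        gcongr
        exact le_max_right _ _
  refine ⟨1 / 2, by norm_num, fun n α hα _ => ⟨fun p => c ^ p, fun p _ => by positivity, ?_⟩⟩
  intro a l hl σ hσ _ hA f _
  obtain ⟨S, hS⟩ := exists_greedy_set (IsDyadicSub.wellFounded_ssuperset (a := a) hl)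
    (fun R Q => ENNReal.ofReal c * fracAvg α f R.1 < fracAvg α f Q.1)
  have hdy : ∀ Q ∈ Subtype.val '' S, IsDyadicSub a l Q := by
    rintro _ ⟨Q, -, rfl⟩
    exact Q.2
  set T : Set (Rn n) → Set (Set (Rn n)) := fun Q => {R | R ∈ Subtype.val '' S ∧ R ⊂ Q}
  have hTm : ∀ Q, MeasurableSet (⋃₀ T Q) := fun Q =>
    MeasurableSet.sUnion (countable_setOf_isDyadicSub.mono fun R hR => hdy R hR.1)
      fun R hR => (hdy R hR.1).measurableSet
  refine ⟨Subtype.val '' S, hdy, ⟨fun Q => Q \ ⋃₀ T Q, fun Q hQ => ⟨?_, sdiff_subset, ?_⟩, ?_⟩, ?_⟩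
  · exact (hdy Q hQ).measurableSet.diff (hTm Q)
  · refine half_wMass_le_diff hl hCσ hδσ hc0 hcC hσ hA (hdy Q hQ) (hTm Q)
      (sUnion_subset fun R hR => hR.2.1) (volume_sUnion_le hl hα f (hdy Q hQ) ?_)
    rintro _ ⟨⟨R, hR, rfl⟩, hRQ⟩
    obtain ⟨Q, hQS, rfl⟩ := hQ
    exact ⟨R.2, hRQ.1, (hS R).mp hR Q hRQ hQS⟩
  · intro Q hQ R hR hne
    rcases (hdy Q hQ).disjoint_or_subset hl (hdy R hR) with h | h | h
    · exact h.mono sdiff_subset sdiff_subset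
    · exact disjoint_left.mpr fun x hx hx' =>
        hx'.2 ⟨Q, ⟨hQ, h.ssubset_of_ne hne⟩, hx.1⟩
    · exact disjoint_left.mpr fun x hx hx' =>
        hx.2 ⟨R, ⟨hR, h.ssubset_of_ne hne.symm⟩, hx'.1⟩
  · intro p hp
    have hp0 : 0 < p := zero_lt_one.trans_le hp
    refine Filter.Eventually.of_forall fun x _ => ?_
    rw [← ENNReal.le_rpow_inv_iff hp0]
    refine iSup_le fun R => iSup_le fun hR => iSup_le fun hxR => ?_
    rw [ENNReal.le_rpow_inv_iff hp0]
    obtain ⟨Q, hQS, hRQ, hle⟩ : ∃ Q ∈ S, R ⊆ Q.1 ∧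
        fracAvg α f R ≤ ENNReal.ofReal c * fracAvg α f Q.1 := by
      by_cases h : (⟨R, hR⟩ : {Q : Set (Rn n) // IsDyadicSub a l Q}) ∈ S
      · exact ⟨_, h, Subset.rfl, le_mul_of_one_le_left' (ENNReal.one_le_ofReal.mpr hc1)⟩
      · rw [hS] at h
        push Not at h
        obtain ⟨Q, hRQ, hQ, hle⟩ := h
        exact ⟨Q, hQ, hRQ.1, hle⟩
    calc fracAvg α f R ^ p ≤ (ENNReal.ofReal c * fracAvg α f Q.1) ^ p := by gcongr
      _ = ENNReal.ofReal (c ^ p) * fracAvg α f Q.1 ^ p := by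
        rw [ENNReal.mul_rpow_of_nonneg _ _ hp0.le, ENNReal.ofReal_rpow_of_pos hc0]
      _ ≤ _ := by
        gcongr
        refine le_trans (le_of_eq ?_)
          (ENNReal.le_tsum (⟨Q.1, Q, hQS, rfl⟩ : (Subtype.val '' S : Set (Set (Rn n)))))
        rw [Set.indicator_of_mem (hRQ hxR)]
        rfl
end
end

section
/- Distance-weight Poincaré inequality on a cube: let 1 < p ≤ q ≤ np/(n−p) < ∞, and let E ⊂ ℝ^n be a nonempty closed set such that, with exponent γ = −n + (q/p)(n−p), there is a constant C_1 = C_1(n,p,q,E) with |Q(z,r)|^{-1}∫_{Q(z,r)} d(x,E)^{γ} dx ≤ C_1 r^{γ} for every z ∈ E and r > 0. Then there exists a constant C = C(n, p, q, C_1) > 0 such that for every cube Q ⊂ ℝ^n and every u ∈ Lip(Q), (∫_Q |u(x) − u_Q|^q d(x,E)^{γ} dx)^{1/q} ≤ C (∫_Q |∇u(x)|^p dx)^{1/p}. -/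
open MeasureTheory ENNReal NNReal Set

noncomputable section

/-- The half-open cube `Q(z, r)` with midpoint `z` and side length `2r`. -/
def CubeC {n : ℕ} (z : Rn n) (r : ℝ) : Set (Rn n) :=
  {y | ∀ i, z i - r ≤ y i ∧ y i < z i + r}

/-- The distance weight `d(x, E)^γ`, with the convention `0^γ = ∞` for `γ < 0`
(extended-real valued power of the distance to `E`). -/
def distWeight {n : ℕ} (E : Set (Rn n)) (γ : ℝ) (x : Rn n) : ℝ≥0∞ :=
  ENNReal.ofReal (Metric.infDist x E) ^ γ

lemma lintegral_rpow_le_weighted {α : Type*} [MeasurableSpace α] {μ : Measure α} {p : ℝ}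
    (hp : 1 ≤ p) {f w : α → ℝ≥0∞} (hf : AEMeasurable f μ) (hw : AEMeasurable w μ)
    (hw0 : ∀ᵐ x ∂μ, w x ≠ 0) (hwt : ∀ᵐ x ∂μ, w x ≠ ∞) :
    (∫⁻ x, f x ∂μ) ^ p ≤ (∫⁻ x, w x ∂μ) ^ (p - 1) * ∫⁻ x, f x ^ p * w x ^ (1 - p) ∂μ := by
  rcases hp.eq_or_lt with rfl | hp
  · simp
  have hp0 : 0 < p := by linarith
  have hc : p.HolderConjugate (p / (p - 1)) := Real.HolderConjugate.conjExponent hp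
  have key := ENNReal.lintegral_mul_le_Lp_mul_Lq μ hc
    (f := fun x => f x * w x ^ ((1 - p) / p)) (g := fun x => w x ^ ((p - 1) / p))
    (hf.mul (hw.pow_const _)) (hw.pow_const _)
  have h1 : ∫⁻ x, f x ∂μ =
      ∫⁻ x, ((fun x => f x * w x ^ ((1 - p) / p)) * fun x => w x ^ ((p - 1) / p)) x ∂μ := by
    apply lintegral_congr_ae
    filter_upwards [hw0, hwt] with x h0 ht
    simp only [Pi.mul_apply]
    rw [mul_assoc, ← ENNReal.rpow_add _ _ h0 ht, ← add_div]
    simp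
  have h2 : ∀ x, (f x * w x ^ ((1 - p) / p)) ^ p = f x ^ p * w x ^ (1 - p) := by
    intro x
    rw [ENNReal.mul_rpow_of_nonneg _ _ hp0.le, ← ENNReal.rpow_mul, div_mul_cancel₀ _ hp0.ne']
  have h3 : ∀ x, (w x ^ ((p - 1) / p)) ^ (p / (p - 1)) = w x := by
    intro x
    have : p - 1 ≠ 0 := by linarith
    rw [← ENNReal.rpow_mul, div_mul_div_cancel₀ hp0.ne', div_self this, ENNReal.rpow_one]
  simp only [h2, h3] at key
  rw [h1]
  refine (ENNReal.rpow_le_rpow key hp0.le).trans ?_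
  have : p - 1 ≠ 0 := by linarith
  rw [ENNReal.mul_rpow_of_nonneg _ _ hp0.le, ← ENNReal.rpow_mul, ← ENNReal.rpow_mul, mul_comm]
  rw [one_div_mul_cancel hp0.ne', ENNReal.rpow_one, one_div_div, div_mul_cancel₀ _ hp0.ne']

lemma lintegral_rpow_le {α : Type*} [MeasurableSpace α] {μ : Measure α} {p : ℝ}
    (hp : 1 ≤ p) {f : α → ℝ≥0∞} (hf : AEMeasurable f μ) :
    (∫⁻ x, f x ∂μ) ^ p ≤ μ univ ^ (p - 1) * ∫⁻ x, f x ^ p ∂μ := by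
  simpa using lintegral_rpow_le_weighted hp hf (w := fun _ => 1) aemeasurable_const
    (by simp) (by simp)

lemma sum_rpow_le_weighted {p : ℝ} (hp : 1 ≤ p) (k : ℕ) (b w : ℕ → ℝ≥0∞)
    (hw0 : ∀ i, w i ≠ 0) (hwt : ∀ i, w i ≠ ∞) :
    (∑ i ∈ Finset.range k, b i) ^ p ≤ (∑ i ∈ Finset.range k, w i) ^ (p - 1) *
      ∑ i ∈ Finset.range k, b i ^ p * w i ^ (1 - p) := by
  have := lintegral_rpow_le_weighted (μ := (Measure.count : Measure (Fin k))) hp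
    (f := fun i => b i) (w := fun i => w i) (by fun_prop) (by fun_prop)
    (Filter.Eventually.of_forall fun i => hw0 i) (Filter.Eventually.of_forall fun i => hwt i)
  simpa [lintegral_count, tsum_fintype, ← Fin.sum_univ_eq_sum_range] using this

section cube
variable {n : ℕ}

lemma cubeC_eq_preimage (z : Rn n) (r : ℝ) :
    CubeC z r = WithLp.ofLp ⁻¹' (Set.pi univ fun i => Ico (z i - r) (z i + r)) := by
  ext y; simp [CubeC, Set.mem_pi]

lemma measurableSet_cubeC (z : Rn n) (r : ℝ) : MeasurableSet (CubeC z r) := by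
  rw [cubeC_eq_preimage]
  exact (MeasurableSet.univ_pi fun i => measurableSet_Ico).preimage (by fun_prop)

lemma volume_cubeC (z : Rn n) (r : ℝ) :
    volume (CubeC z r) = ENNReal.ofReal (2 * r) ^ n := by
  rw [cubeC_eq_preimage, (PiLp.volume_preserving_ofLp (Fin n)).measure_preimage
    (MeasurableSet.univ_pi fun i => measurableSet_Ico).nullMeasurableSet, volume_pi_pi]
  simp only [Real.volume_Ico]
  simp [show ∀ a : ℝ, a + r - (a - r) = 2 * r by intro a; ring]

lemma volume_cubeC_ne_zero (z : Rn n) {r : ℝ} (hr : 0 < r) : volume (CubeC z r) ≠ 0 := by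
  rw [volume_cubeC]; simp [hr]

lemma volume_cubeC_ne_top (z : Rn n) (r : ℝ) : volume (CubeC z r) ≠ ∞ := by
  rw [volume_cubeC]; exact ENNReal.pow_ne_top ENNReal.ofReal_ne_top

lemma norm_le_sqrt_mul {v : Rn n} {a : ℝ} (ha : 0 ≤ a) (h : ∀ i, |v i| ≤ a) :
    ‖v‖ ≤ √n * a := by
  rw [EuclideanSpace.norm_eq]
  apply Real.sqrt_le_iff.2
  refine ⟨by positivity, ?_⟩
  rw [mul_pow, Real.sq_sqrt (by positivity)]
  calc ∑ i, ‖v i‖ ^ 2 ≤ ∑ i : Fin n, a ^ 2 := by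
        gcongr with i; exact h i
    _ = _ := by simp

lemma convex_cubeC (z : Rn n) (r : ℝ) : Convex ℝ (CubeC z r) := by
  rw [cubeC_eq_preimage]
  exact (convex_pi fun i _ => convex_Ico _ _).linear_preimage
    (WithLp.linearEquiv 2 ℝ (Fin n → ℝ)).toLinearMap

lemma cubeC_subset_closedBall (z : Rn n) {r : ℝ} (hr : 0 ≤ r) :
    CubeC z r ⊆ Metric.closedBall z (√n * r) := by
  intro y hy
  rw [Metric.mem_closedBall, dist_eq_norm]
  refine norm_le_sqrt_mul hr fun i => ?_
  have := hy i
  simp only [PiLp.sub_apply]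
  exact abs_le.2 ⟨by linarith, by linarith⟩

lemma LipschitzWith.integrableOn_cubeC {u : Rn n → ℝ} {L : ℝ≥0} (hu : LipschitzWith L u)
    (z : Rn n) {r : ℝ} (hr : 0 ≤ r) : IntegrableOn u (CubeC z r) :=
  (hu.continuous.continuousOn.integrableOn_compact (isCompact_closedBall z _)).mono_set
    (cubeC_subset_closedBall z hr)

end cube

section UpperGradient

variable {n : ℕ}

open Classical in
/-- The norm of the gradient of `u`, with the value `∞` at points of non-differentiability. -/
def upperGradient (u : Rn n → ℝ) (x : Rn n) : ℝ≥0∞ :=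
  if DifferentiableAt ℝ u x then ‖fderiv ℝ u x‖ₑ else ∞

lemma measurable_upperGradient (u : Rn n → ℝ) : Measurable (upperGradient u) := by
  classical
  exact Measurable.ite (measurableSet_of_differentiableAt ℝ u) (measurable_fderiv ℝ u).enorm
    measurable_const

lemma LipschitzWith.upperGradient_ae_eq {u : Rn n → ℝ} {L : ℝ≥0} (hu : LipschitzWith L u) :
    ∀ᵐ x, upperGradient u x = ‖fderiv ℝ u x‖ₑ := by
  filter_upwards [hu.ae_differentiableAt] with x hx
  simp [upperGradient, hx]

lemma LipschitzWith.enorm_comp_line_sub_le {u : Rn n → ℝ} {L : ℝ≥0} (hu : LipschitzWith L u)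
    {ψ : ℝ → ℝ} (hψ : ContDiff ℝ 1 ψ) (a v : Rn n) (s t : ℝ) :
    ‖ψ (u (a + t • v)) - ψ (u (a + s • v))‖ₑ ≤
      ∫⁻ τ in uIoc s t, ‖deriv ψ (u (a + τ • v))‖ₑ * (‖v‖ₑ * upperGradient u (a + τ • v)) := by
  set l : ℝ → ℝ := fun τ => u (a + τ • v) with hl
  have hline : LipschitzWith ‖v‖₊ (fun τ : ℝ => a + τ • v) := by
    refine LipschitzWith.of_dist_le_mul fun x y => ?_
    rw [dist_add_left, dist_eq_norm, ← sub_smul, norm_smul, mul_comm]; simp [dist_eq_norm]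
  have hlLip : LipschitzWith (L * ‖v‖₊) l := hu.comp hline
  obtain ⟨K, hK⟩ := (hψ.locallyLipschitz.comp hlLip.locallyLipschitz).locallyLipschitzOn
    (s := uIcc s t) |>.exists_lipschitzOnWith_of_compact isCompact_uIcc
  have hFTC := hK.absolutelyContinuousOnInterval.integral_deriv_eq_sub
  have h1 : ‖ψ (l t) - ψ (l s)‖ₑ ≤ ∫⁻ τ in uIoc s t, ‖deriv (ψ ∘ l) τ‖ₑ := by
    have : ψ (l t) - ψ (l s) = ∫ τ in s..t, deriv (ψ ∘ l) τ := hFTC.symm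
    rw [this, ← ofReal_norm, intervalIntegral.norm_integral_eq_norm_integral_uIoc, ofReal_norm]
    exact enorm_integral_le_lintegral_enorm _
  refine h1.trans (lintegral_mono_ae ?_)
  refine ae_restrict_of_ae ?_
  filter_upwards [hlLip.ae_differentiableAt_real] with τ hτ
  rw [deriv_comp _ (hψ.differentiable one_ne_zero _) hτ, enorm_mul]
  gcongr
  unfold upperGradient
  split_ifs with hd
  · have : HasDerivAt l (fderiv ℝ u (a + τ • v) v) τ := by
      have h2 : HasDerivAt (fun τ : ℝ => a + τ • v) v τ := by
        simpa using ((hasDerivAt_id τ).smul_const v).const_add a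
      exact hd.hasFDerivAt.comp_hasDerivAt τ h2
    rw [this.deriv, mul_comm]
    exact ContinuousLinearMap.le_opENorm _ _
  · rcases eq_or_ne v 0 with rfl | hv
    · have : l = fun _ => u a := by ext; simp [hl]
      simp [this]
    · rw [ENNReal.mul_top (by simpa using hv)]; exact le_top

lemma LipschitzWith.enorm_add_sub_le {u : Rn n → ℝ} {L : ℝ≥0} (hu : LipschitzWith L u)
    (a v : Rn n) :
    ‖u (a + v) - u a‖ₑ ≤ ‖v‖ₑ * ∫⁻ τ in Ioc (0 : ℝ) 1, upperGradient u (a + τ • v) := by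
  have := hu.enorm_comp_line_sub_le (ψ := id) contDiff_id a v 0 1
  have hm : Measurable fun τ : ℝ => upperGradient u (a + τ • v) :=
    (measurable_upperGradient u).comp (by fun_prop)
  rw [← lintegral_const_mul _ hm]
  simpa using this

/-- The `L^p` Poincaré inequality on cubes, in terms of the double integral of differences. -/
lemma LipschitzWith.lintegral_lintegral_enorm_sub_le {u : Rn n → ℝ} {L : ℝ≥0}
    (hu : LipschitzWith L u) {p : ℝ} (hp : 1 ≤ p) (z : Rn n) {r : ℝ} (hr : 0 < r) :
    ∫⁻ x in CubeC z r, ∫⁻ y in CubeC z r, ‖u y - u x‖ₑ ^ p ≤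
      ENNReal.ofReal (4 * r) ^ n * ENNReal.ofReal (√n * (2 * r)) ^ p *
        ∫⁻ x in CubeC z r, upperGradient u x ^ p := by
  set Q := CubeC z r with hQ
  have hQm : MeasurableSet Q := measurableSet_cubeC z r
  set G := upperGradient u with hG
  have hGm : Measurable G := measurable_upperGradient u
  have hp0 : 0 ≤ p := by linarith
  set V : Set (Rn n) := CubeC 0 (2 * r) with hV
  have hVm : MeasurableSet V := measurableSet_cubeC _ _
  set c := ENNReal.ofReal (√n * (2 * r)) ^ p with hc
  have hdiff : ∀ x v, x ∈ Q → x + v ∈ Q →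
      ‖u (x + v) - u x‖ₑ ^ p ≤
        V.indicator (fun _ => c) v *
          ∫⁻ τ in Ioc (0 : ℝ) 1, Q.indicator (fun y => G y ^ p) (x + τ • v) := by
    intro x v hx hxv
    have hv : ∀ i, |v i| < 2 * r := by
      intro i
      have h1 := hx i
      have h2 := hxv i
      simp only [PiLp.add_apply] at h2
      exact abs_lt.2 ⟨by linarith, by linarith⟩
    have hvV : v ∈ V := fun i => by
      have := abs_lt.1 (hv i)
      simp only [PiLp.zero_apply]
      exact ⟨by linarith, by linarith⟩
    rw [indicator_of_mem hvV]
    refine (ENNReal.rpow_le_rpow (hu.enorm_add_sub_le x v) hp0).trans ?_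
    rw [ENNReal.mul_rpow_of_nonneg _ _ hp0]
    gcongr
    · rw [← ofReal_norm, hc]
      gcongr
      exact norm_le_sqrt_mul (by positivity) fun i => (hv i).le
    · refine (lintegral_rpow_le hp ?_).trans ?_
      · exact (hGm.comp (by fun_prop)).aemeasurable
      simp only [Measure.restrict_apply MeasurableSet.univ, univ_inter, Real.volume_Ioc, sub_zero,
        ENNReal.ofReal_one, ENNReal.one_rpow, one_mul]
      refine setLIntegral_mono' measurableSet_Ioc fun τ hτ => ?_
      have : x + τ • v ∈ Q := by
        have := convex_cubeC z r hx hxv (a := 1 - τ) (b := τ) (by linarith [hτ.2]) hτ.1.le (by ring)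
        convert this using 1
        rw [smul_add, ← add_assoc, ← add_smul]; simp
      rw [indicator_of_mem this]
  have hGi : Measurable (Q.indicator fun y => G y ^ p) := (hGm.pow_const _).indicator hQm
  calc ∫⁻ x in Q, ∫⁻ y in Q, ‖u y - u x‖ₑ ^ p
      = ∫⁻ x in Q, ∫⁻ v, Q.indicator (fun y => ‖u y - u x‖ₑ ^ p) (x + v) := by
        congr 1; ext x
        rw [← lintegral_indicator hQm, lintegral_add_left_eq_self]
    _ ≤ ∫⁻ x in Q, ∫⁻ v, V.indicator (fun _ => c) v *
          ∫⁻ τ in Ioc (0 : ℝ) 1, Q.indicator (fun y => G y ^ p) (x + τ • v) := by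
        refine setLIntegral_mono' hQm fun x hx => lintegral_mono fun v => ?_
        by_cases hxv : x + v ∈ Q
        · rw [indicator_of_mem hxv]; exact hdiff x v hx hxv
        · rw [indicator_of_notMem hxv]; exact zero_le
    _ ≤ ∫⁻ x, ∫⁻ v, V.indicator (fun _ => c) v *
          ∫⁻ τ in Ioc (0 : ℝ) 1, Q.indicator (fun y => G y ^ p) (x + τ • v) :=
        setLIntegral_le_lintegral _ _
    _ = ∫⁻ v, V.indicator (fun _ => c) v * ∫⁻ x,
          ∫⁻ τ in Ioc (0 : ℝ) 1, Q.indicator (fun y => G y ^ p) (x + τ • v) := by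
        have hm : Measurable fun q : Rn n × Rn n =>
            ∫⁻ τ in Ioc (0 : ℝ) 1, Q.indicator (fun y => G y ^ p) (q.1 + τ • q.2) :=
          (hGi.comp (by fun_prop : Measurable fun w : (Rn n × Rn n) × ℝ =>
            w.1.1 + w.2 • w.1.2)).lintegral_prod_right'
        rw [lintegral_lintegral_swap]
        · congr 1; ext v
          rw [lintegral_const_mul]
          exact hm.comp (by fun_prop : Measurable fun x : Rn n => (x, v))
        · exact (((measurable_const.indicator hVm).comp measurable_snd).mul hm).aemeasurable
    _ = ∫⁻ v, V.indicator (fun _ => c) v * ∫⁻ x in Q, G x ^ p := by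
        congr 1; ext v
        congr 1
        rw [lintegral_lintegral_swap]
        · simp only [lintegral_add_right_eq_self (Q.indicator fun y => G y ^ p)]
          simp [lintegral_indicator hQm]
        · exact (hGi.comp (by fun_prop : Measurable fun w : Rn n × ℝ =>
            w.1 + w.2 • v)).aemeasurable
    _ = _ := by
        rw [lintegral_mul_const _ (measurable_const.indicator hVm), lintegral_indicator hVm,
          setLIntegral_const, hV, volume_cubeC, mul_comm c]
        congr 4; ring

lemma LipschitzWith.enorm_sub_average_le {u : Rn n → ℝ} {L : ℝ≥0} (hu : LipschitzWith L u)
    (z : Rn n) {r : ℝ} (hr : 0 < r) (c : ℝ) :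
    ‖c - ⨍ y in CubeC z r, u y‖ₑ ≤
      (volume (CubeC z r))⁻¹ * ∫⁻ y in CubeC z r, ‖u y - c‖ₑ := by
  have h0 := volume_cubeC_ne_zero z hr
  have ht := volume_cubeC_ne_top z r
  have hi := hu.integrableOn_cubeC z hr.le
  have : (⨍ y in CubeC z r, u y) - c = ⨍ y in CubeC z r, (u y - c) := by
    have hcc : ⨍ _ in CubeC z r, c = c := setAverage_const h0 ht c
    have hci : IntegrableOn (fun _ => c) (CubeC z r) := integrableOn_const ht
    rw [setAverage_eq] at hcc
    rw [setAverage_eq, setAverage_eq, integral_sub hi hci, smul_sub, hcc]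
  rw [enorm_sub_rev, this, setAverage_eq, enorm_smul]
  gcongr
  · rw [measureReal_def, ← ENNReal.toReal_inv, Real.enorm_eq_ofReal ENNReal.toReal_nonneg,
      ENNReal.ofReal_toReal (by simp [h0])]
  · exact enorm_integral_le_lintegral_enorm _

/-- The `L^p` Poincaré inequality on cubes. -/
theorem LipschitzWith.poincare_cubeC {u : Rn n → ℝ} {L : ℝ≥0}
    (hu : LipschitzWith L u) {p : ℝ} (hp : 1 ≤ p) (z : Rn n) {r : ℝ} (hr : 0 < r) :
    ∫⁻ x in CubeC z r, ‖u x - ⨍ y in CubeC z r, u y‖ₑ ^ p ≤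
      2 ^ n * ENNReal.ofReal (√n * (2 * r)) ^ p *
        ∫⁻ x in CubeC z r, upperGradient u x ^ p := by
  have hp0 : 0 ≤ p := by linarith
  have h0 := volume_cubeC_ne_zero z hr
  have ht := volume_cubeC_ne_top z r
  set Q := CubeC z r with hQ
  have hum := hu.continuous.measurable
  calc ∫⁻ x in Q, ‖u x - ⨍ y in Q, u y‖ₑ ^ p
      ≤ ∫⁻ x in Q, (volume Q)⁻¹ * ∫⁻ y in Q, ‖u y - u x‖ₑ ^ p := by
        refine lintegral_mono fun x => ?_
        refine (ENNReal.rpow_le_rpow (hu.enorm_sub_average_le z hr (u x)) hp0).trans ?_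
        rw [ENNReal.mul_rpow_of_nonneg _ _ hp0]
        have hJ := lintegral_rpow_le (μ := volume.restrict Q) (f := fun y => ‖u y - u x‖ₑ) hp
          (by fun_prop)
        rw [Measure.restrict_apply_univ] at hJ
        calc _ ≤ (volume Q)⁻¹ ^ p * (volume Q ^ (p - 1) * ∫⁻ y in Q, ‖u y - u x‖ₑ ^ p) := by
              gcongr
          _ = _ := by
            rw [← mul_assoc, ENNReal.inv_rpow, ← ENNReal.rpow_neg, ← ENNReal.rpow_add _ _ h0 ht,
              show -p + (p - 1) = -1 by ring, ENNReal.rpow_neg_one]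
    _ = (volume Q)⁻¹ * ∫⁻ x in Q, ∫⁻ y in Q, ‖u y - u x‖ₑ ^ p := by
        rw [lintegral_const_mul']
        simp [h0]
    _ ≤ (volume Q)⁻¹ * (ENNReal.ofReal (4 * r) ^ n * ENNReal.ofReal (√n * (2 * r)) ^ p *
        ∫⁻ x in Q, upperGradient u x ^ p) := by
        gcongr; exact hu.lintegral_lintegral_enorm_sub_le hp z hr
    _ = _ := by
        have : ENNReal.ofReal (4 * r) ^ n = volume Q * 2 ^ n := by
          rw [hQ, volume_cubeC, ← mul_pow, show 4 * r = (2 * r) * 2 by ring,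
            ENNReal.ofReal_mul (by positivity)]
          simp
        rw [this, ← mul_assoc, ← mul_assoc, ← mul_assoc, ENNReal.inv_mul_cancel h0 ht, one_mul]

end UpperGradient

section SobolevPoincare

variable {n : ℕ}

lemma setLIntegral_cubeC_eq_pi (z : Rn n) (r : ℝ) (f : Rn n → ℝ≥0∞) :
    ∫⁻ x in CubeC z r, f x = ∫⁻ x, f (WithLp.toLp 2 x)
      ∂(Measure.pi fun i => (volume : Measure ℝ).restrict (Ico (z i - r) (z i + r))) := by
  rw [← Measure.restrict_pi_pi, ← volume_pi]
  rw [← (PiLp.volume_preserving_toLp (Fin n)).setLIntegral_comp_preimage_emb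
    (MeasurableEquiv.toLp 2 (Fin n → ℝ)).measurableEmbedding]
  rw [cubeC_eq_preimage]
  rfl

lemma LipschitzWith.enorm_comp_le_lintegral_line {u : Rn n → ℝ} {L : ℝ≥0}
    (hu : LipschitzWith L u) {ψ : ℝ → ℝ} (hψ : ContDiff ℝ 1 ψ) {z : Rn n} {r : ℝ} (hr : 0 < r)
    {x : Fin n → ℝ} (i : Fin n) (hx : x i ∈ Ico (z i - r) (z i + r)) :
    ‖ψ (u (WithLp.toLp 2 x))‖ₑ ≤ ∫⁻ s in Ico (z i - r) (z i + r),
      (‖ψ (u (WithLp.toLp 2 (Function.update x i s)))‖ₑ * (ENNReal.ofReal (2 * r))⁻¹ +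
        ‖deriv ψ (u (WithLp.toLp 2 (Function.update x i s)))‖ₑ *
          upperGradient u (WithLp.toLp 2 (Function.update x i s))) := by
  set I := Ico (z i - r) (z i + r) with hI
  set e : Rn n := EuclideanSpace.single i 1 with he
  set a : Rn n := WithLp.toLp 2 (Function.update x i 0) with ha
  have hline : ∀ s, WithLp.toLp 2 (Function.update x i s) = a + s • e := by
    intro s
    ext j
    by_cases hj : j = i
    · subst hj; simp [ha, he]
    · simp [ha, he, hj]
  have hxline : WithLp.toLp 2 x = a + x i • e := by rw [← hline]; simp
  have hem : ‖e‖ₑ = 1 := by simp [he, ← ofReal_norm]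
  simp only [hline, hxline]
  have hψm : Measurable fun s : ℝ => ‖ψ (u (a + s • e))‖ₑ := by
    have := hψ.continuous.measurable
    have := hu.continuous.measurable
    fun_prop
  have hvol : volume I = ENNReal.ofReal (2 * r) := by
    rw [hI, Real.volume_Ico]; congr 1; ring
  have hv0 : ENNReal.ofReal (2 * r) ≠ 0 := by simp [hr]
  set T := ∫⁻ s in I, ‖deriv ψ (u (a + s • e))‖ₑ * upperGradient u (a + s • e) with hT
  have hpt : ∀ s ∈ I, ‖ψ (u (a + x i • e))‖ₑ ≤ ‖ψ (u (a + s • e))‖ₑ + T := by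
    intro s hs
    have h1 := hu.enorm_comp_line_sub_le hψ a e s (x i)
    simp only [hem, one_mul] at h1
    have h2 : ‖ψ (u (a + x i • e))‖ₑ ≤ ‖ψ (u (a + s • e))‖ₑ +
        ‖ψ (u (a + x i • e)) - ψ (u (a + s • e))‖ₑ := by
      convert enorm_add_le _ _ using 2
      · ring
    refine h2.trans (add_le_add le_rfl (h1.trans ?_))
    refine lintegral_mono_set ?_
    intro τ hτ
    rcases le_total s (x i) with h | h
    · rw [uIoc_of_le h] at hτ; exact ⟨hs.1.trans hτ.1.le, hτ.2.trans_lt hx.2⟩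
    · rw [uIoc_of_ge h] at hτ; exact ⟨hx.1.trans hτ.1.le, hτ.2.trans_lt hs.2⟩
  have h_int : ‖ψ (u (a + x i • e))‖ₑ * ENNReal.ofReal (2 * r) ≤
      (∫⁻ s in I, ‖ψ (u (a + s • e))‖ₑ) + T * ENNReal.ofReal (2 * r) := by
    have := setLIntegral_mono' (μ := volume) measurableSet_Ico hpt
    rwa [lintegral_add_left hψm, setLIntegral_const, setLIntegral_const, hvol] at this
  rw [lintegral_add_left (hψm.mul_const _), lintegral_mul_const _ hψm, ← hT]
  calc ‖ψ (u (a + x i • e))‖ₑ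
      = ‖ψ (u (a + x i • e))‖ₑ * ENNReal.ofReal (2 * r) * (ENNReal.ofReal (2 * r))⁻¹ := by
        rw [mul_assoc, ENNReal.mul_inv_cancel hv0 ENNReal.ofReal_ne_top, mul_one]
    _ ≤ ((∫⁻ s in I, ‖ψ (u (a + s • e))‖ₑ) + T * ENNReal.ofReal (2 * r)) *
        (ENNReal.ofReal (2 * r))⁻¹ := by gcongr
    _ = _ := by
        rw [add_mul, mul_assoc T, ENNReal.mul_inv_cancel hv0 ENNReal.ofReal_ne_top, mul_one]

/-- The Gagliardo--Nirenberg inequality with exponent `1` on a cube. -/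
lemma LipschitzWith.gagliardo_cubeC {u : Rn n → ℝ} {L : ℝ≥0}
    (hu : LipschitzWith L u) {ψ : ℝ → ℝ} (hψ : ContDiff ℝ 1 ψ) (hn : 2 ≤ n) (z : Rn n) {r : ℝ}
    (hr : 0 < r) :
    ∫⁻ x in CubeC z r, ‖ψ (u x)‖ₑ ^ ((n : ℝ) / (n - 1)) ≤
      (∫⁻ x in CubeC z r, (‖ψ (u x)‖ₑ * (ENNReal.ofReal (2 * r))⁻¹ +
        ‖deriv ψ (u x)‖ₑ * upperGradient u x)) ^ ((n : ℝ) / (n - 1)) := by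
  have hn1 : (1 : ℝ) < n := by exact_mod_cast hn
  have hn1' : (0 : ℝ) < n - 1 := by linarith
  set f : Rn n → ℝ≥0∞ := fun x => ‖ψ (u x)‖ₑ * (ENNReal.ofReal (2 * r))⁻¹ +
        ‖deriv ψ (u x)‖ₑ * upperGradient u x with hf
  have hfm : Measurable f := by
    have h1 := hψ.continuous.measurable
    have h2 := hu.continuous.measurable
    have h3 := measurable_upperGradient u
    have h4 := measurable_deriv ψ
    fun_prop
  have hc : Real.HolderConjugate (Fintype.card (Fin n)) ((n : ℝ) / (n - 1)) := by
    rw [Fintype.card_fin]; exact Real.HolderConjugate.conjExponent hn1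
  have key := lintegral_prod_lintegral_pow_le
    (μ := fun i : Fin n => (volume : Measure ℝ).restrict (Ico (z i - r) (z i + r))) hc
    (f := fun x => f (WithLp.toLp 2 x)) (hfm.comp (by fun_prop))
  rw [setLIntegral_cubeC_eq_pi, setLIntegral_cubeC_eq_pi]
  refine le_trans ?_ key
  refine lintegral_mono_ae ?_
  have hmem : ∀ᵐ x ∂(Measure.pi fun i : Fin n =>
      (volume : Measure ℝ).restrict (Ico (z i - r) (z i + r))),
      x ∈ Set.pi univ fun i => Ico (z i - r) (z i + r) := by
    rw [← Measure.restrict_pi_pi]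
    exact ae_restrict_mem (MeasurableSet.univ_pi fun i => measurableSet_Ico)
  filter_upwards [hmem] with x hx
  have : ‖ψ (u (WithLp.toLp 2 x))‖ₑ ^ ((n : ℝ) / (n - 1)) =
      ∏ i : Fin n, ‖ψ (u (WithLp.toLp 2 x))‖ₑ ^ ((1 : ℝ) / (n - 1)) := by
    rw [Finset.prod_const, Finset.card_fin, ← ENNReal.rpow_natCast, ← ENNReal.rpow_mul]
    congr 1; ring
  rw [this, Fintype.card_fin]
  gcongr with i
  exact hu.enorm_comp_le_lintegral_line hψ hr i (hx i (mem_univ i))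

lemma ENNReal.le_rpow_of_le_rpow_mul {I J : ℝ≥0∞} {a b : ℝ} (hI : I ≠ ∞) (ha : a < 1)
    (h : I ≤ I ^ a * J ^ b) : I ≤ J ^ (b / (1 - a)) := by
  rcases eq_or_ne I 0 with rfl | h0
  · exact zero_le
  have ha' : 0 < 1 - a := by linarith
  have h1 : I ^ (1 - a) ≤ J ^ b := by
    calc I ^ (1 - a) = I * I ^ (-a) := by
          rw [sub_eq_add_neg, ENNReal.rpow_add _ _ h0 hI, ENNReal.rpow_one]
      _ ≤ I ^ a * J ^ b * I ^ (-a) := by gcongr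
      _ = (I ^ a * I ^ (-a)) * J ^ b := by ring
      _ = _ := by rw [← ENNReal.rpow_add _ _ h0 hI]; simp
  calc I = (I ^ (1 - a)) ^ (1 / (1 - a)) := by
        rw [← ENNReal.rpow_mul, mul_one_div_cancel ha'.ne', ENNReal.rpow_one]
    _ ≤ (J ^ b) ^ (1 / (1 - a)) := by gcongr
    _ = _ := by rw [← ENNReal.rpow_mul]; congr 1; ring

lemma enorm_abs_rpow {s : ℝ} (hs : 0 ≤ s) (y : ℝ) : ‖|y| ^ s‖ₑ = ‖y‖ₑ ^ s := by
  rw [Real.enorm_of_nonneg (by positivity), ← ENNReal.ofReal_rpow_of_nonneg (abs_nonneg _) hs,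
    ← Real.norm_eq_abs, ofReal_norm]

lemma contDiff_abs_sub_rpow {t : ℝ} (ht : 1 < t) (c : ℝ) :
    ContDiff ℝ 1 fun y : ℝ => |y - c| ^ t := by
  simpa [Real.norm_eq_abs, Function.comp_def] using (contDiff_norm_rpow (E := ℝ) ht).comp
    (contDiff_id.sub (contDiff_const (c := c)))

lemma enorm_deriv_abs_sub_rpow {t : ℝ} (ht : 1 < t) (c y : ℝ) :
    ‖deriv (fun y : ℝ => |y - c| ^ t) y‖ₑ ≤ ENNReal.ofReal t * ‖y - c‖ₑ ^ (t - 1) := by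
  have h : HasDerivAt (fun y : ℝ => |y - c| ^ t) (t * |y - c| ^ (t - 2) * (y - c)) y := by
    simpa [Function.comp_def] using
      (hasDerivAt_abs_rpow (y - c) ht).comp y ((hasDerivAt_id y).sub_const c)
  have h' : ‖t * |y - c| ^ (t - 2) * (y - c)‖ ≤ t * |y - c| ^ (t - 1) := by
    rw [norm_mul, norm_mul, Real.norm_of_nonneg (by linarith : 0 ≤ t), mul_assoc]
    rw [Real.norm_of_nonneg (by positivity), Real.norm_eq_abs]
    rcases eq_or_ne (y - c) 0 with h0 | h0
    · rw [h0]; simp; exact mul_nonneg (by linarith) (Real.rpow_nonneg le_rfl _)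
    · have : |y - c| ^ (t - 1) = |y - c| ^ (t - 2) * |y - c| := by
        rw [← Real.rpow_add_one (by simpa using h0)]; congr 1; ring
      rw [this]
  rw [h.deriv, ← ofReal_norm]
  refine (ENNReal.ofReal_le_ofReal h').trans_eq ?_
  rw [ENNReal.ofReal_mul (by linarith), ← ENNReal.ofReal_rpow_of_nonneg (abs_nonneg _)
    (by linarith), ← Real.norm_eq_abs, ofReal_norm]

/-- The Sobolev--Poincaré inequality on cubes. -/
theorem exists_sobolev_poincare_cubeC (n : ℕ) {p : ℝ} (hp : 1 < p) (hpn : p < n) :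
    ∃ C : ℝ≥0∞, C ≠ ∞ ∧ ∀ (u : Rn n → ℝ) (L : ℝ≥0), LipschitzWith L u →
      ∀ (z : Rn n) (r : ℝ), 0 < r →
      ∫⁻ x in CubeC z r, ‖u x - ⨍ y in CubeC z r, u y‖ₑ ^ (n * p / (n - p)) ≤
        C * (∫⁻ x in CubeC z r, upperGradient u x ^ p) ^ ((n : ℝ) / (n - p)) := by
  have hp0 : 0 < p := by linarith
  have hp1 : 0 < p - 1 := by linarith
  have hnp : 0 < (n : ℝ) - p := by linarith
  have hn1 : 0 < (n : ℝ) - 1 := by linarith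
  have hn0 : 0 < (n : ℝ) := by linarith
  have hn2 : 2 ≤ n := by
    have : (1 : ℝ) < n := by linarith
    exact_mod_cast this
  set t : ℝ := p * (n - 1) / (n - p) with ht
  have ht1 : 1 < t := by rw [ht, lt_div_iff₀ hnp]; nlinarith
  set K : ℝ≥0∞ := 2 ^ (p - 1) * (2 ^ n * ENNReal.ofReal √n ^ p + ENNReal.ofReal t ^ p) with hK
  refine ⟨K ^ ((n : ℝ) / (n - p)), ?_, ?_⟩
  · refine ENNReal.rpow_ne_top_of_nonneg (by positivity) ?_
    refine ENNReal.mul_ne_top (ENNReal.rpow_ne_top_of_nonneg hp1.le (by simp)) ?_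
    refine ENNReal.add_ne_top.2 ⟨ENNReal.mul_ne_top (by simp) ?_, ?_⟩ <;>
    exact ENNReal.rpow_ne_top_of_nonneg hp0.le (by simp)
  intro u L hu z r hr
  set Q := CubeC z r with hQ
  set c := ⨍ y in Q, u y with hc
  set s : ℝ := n * p / (n - p) with hs
  have hs0 : 0 < s := by positivity
  set I := ∫⁻ x in Q, ‖u x - c‖ₑ ^ s with hI
  set ℓ := ENNReal.ofReal (2 * r) with hℓ
  have hℓ0 : ℓ ≠ 0 := by simp [hℓ, hr]
  have hℓt : ℓ ≠ ∞ := ENNReal.ofReal_ne_top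
  set J := ∫⁻ x in Q, (‖u x - c‖ₑ * ℓ⁻¹ + ENNReal.ofReal t * upperGradient u x) ^ p with hJ
  have hum := hu.continuous.measurable
  have hGm := measurable_upperGradient u
  have hItop : I ≠ ∞ := by
    have hcont : Continuous fun x => |u x - c| ^ s :=
      (hu.continuous.sub continuous_const).abs.rpow_const fun _ => Or.inr hs0.le
    have := ((hcont.continuousOn.integrableOn_compact (μ := volume)
      (isCompact_closedBall z (√n * r))).mono_set
      (cubeC_subset_closedBall z hr.le)).2.ne
    simp only [enorm_abs_rpow hs0.le] at this
    exact this
  have hgag := hu.gagliardo_cubeC (contDiff_abs_sub_rpow ht1 c) hn2 z hr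
  have habs : ∀ y : ℝ, ‖|y - c| ^ t‖ₑ = ‖y - c‖ₑ ^ t := fun y =>
    enorm_abs_rpow (by linarith) (y - c)
  have hIJ : I ≤ I ^ ((p - 1) / p * (n / (n - 1))) * J ^ (1 / p * (n / (n - 1))) := by
    have h1 : I = ∫⁻ x in Q, ‖|u x - c| ^ t‖ₑ ^ ((n : ℝ) / (n - 1)) := by
      refine lintegral_congr fun x => ?_
      rw [habs, ← ENNReal.rpow_mul]
      congr 1
      rw [hs, ht]; field_simp
    have hcj : (p / (p - 1)).HolderConjugate p := (Real.HolderConjugate.conjExponent hp).symm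
    have h2 : ∫⁻ x in Q, (‖|u x - c| ^ t‖ₑ * ℓ⁻¹ +
        ‖deriv (fun y : ℝ => |y - c| ^ t) (u x)‖ₑ * upperGradient u x) ≤
        I ^ ((p - 1) / p) * J ^ (1 / p) := by
      have hH := ENNReal.lintegral_mul_le_Lp_mul_Lq (volume.restrict Q) hcj
        (f := fun x => ‖u x - c‖ₑ ^ (t - 1))
        (g := fun x => ‖u x - c‖ₑ * ℓ⁻¹ + ENNReal.ofReal t * upperGradient u x)
        (by fun_prop) (by fun_prop)
      have h3 : ∀ x, (‖u x - c‖ₑ ^ (t - 1)) ^ (p / (p - 1)) = ‖u x - c‖ₑ ^ s := by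
        intro x
        rw [← ENNReal.rpow_mul]
        congr 1
        have : t - 1 = n * (p - 1) / (n - p) := by rw [ht]; field_simp; ring
        rw [this, hs]; field_simp
      simp only [h3, one_div_div] at hH
      refine le_trans (lintegral_mono fun x => ?_) hH
      simp only [Pi.mul_apply]
      rw [habs, mul_add]
      gcongr ?_ + ?_
      · rw [← mul_assoc]
        gcongr
        apply le_of_eq
        conv_rhs => rw [← ENNReal.rpow_one ‖u x - c‖ₑ]
        rw [← ENNReal.rpow_mul, ← ENNReal.rpow_add_of_nonneg _ _ (by linarith) zero_le_one]
        congr 1; ring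
      · rw [← mul_assoc, mul_comm _ (ENNReal.ofReal t)]
        gcongr
        exact enorm_deriv_abs_sub_rpow ht1 c (u x)
    calc I ≤ (∫⁻ x in Q, (‖|u x - c| ^ t‖ₑ * ℓ⁻¹ +
        ‖deriv (fun y : ℝ => |y - c| ^ t) (u x)‖ₑ * upperGradient u x)) ^ ((n : ℝ) / (n - 1)) :=
          h1.trans_le hgag
      _ ≤ (I ^ ((p - 1) / p) * J ^ (1 / p)) ^ ((n : ℝ) / (n - 1)) := by gcongr
      _ = _ := by
        rw [ENNReal.mul_rpow_of_nonneg _ _ (by positivity), ← ENNReal.rpow_mul,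
          ← ENNReal.rpow_mul]
  have hexp : 1 - (p - 1) / p * (n / (n - 1)) = ((n : ℝ) - p) / (p * (n - 1)) := by
    field_simp; ring
  have hfin := ENNReal.le_rpow_of_le_rpow_mul hItop
    (by have : 0 < ((n : ℝ) - p) / (p * (n - 1)) := by positivity
        linarith) hIJ
  rw [hexp, show 1 / p * ((n : ℝ) / (n - 1)) / ((n - p) / (p * (n - 1))) = n / (n - p) by
    field_simp] at hfin
  refine hfin.trans ?_
  rw [← ENNReal.mul_rpow_of_nonneg _ _ (by positivity)]
  gcongr
  calc J ≤ ∫⁻ x in Q, 2 ^ (p - 1) * ((‖u x - c‖ₑ * ℓ⁻¹) ^ p +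
          (ENNReal.ofReal t * upperGradient u x) ^ p) :=
        lintegral_mono fun x => ENNReal.rpow_add_le_mul_rpow_add_rpow _ _ hp.le
    _ = 2 ^ (p - 1) * (ℓ⁻¹ ^ p * (∫⁻ x in Q, ‖u x - c‖ₑ ^ p) +
          ENNReal.ofReal t ^ p * ∫⁻ x in Q, upperGradient u x ^ p) := by
        simp only [ENNReal.mul_rpow_of_nonneg _ _ hp0.le]
        rw [lintegral_const_mul _ (by fun_prop), lintegral_add_left (by fun_prop),
          lintegral_mul_const _ (by fun_prop), lintegral_const_mul _ (by fun_prop),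
          mul_comm (ℓ⁻¹ ^ p)]
    _ ≤ 2 ^ (p - 1) * (ℓ⁻¹ ^ p * (2 ^ n * ENNReal.ofReal (√n * (2 * r)) ^ p *
        ∫⁻ x in Q, upperGradient u x ^ p) +
          ENNReal.ofReal t ^ p * ∫⁻ x in Q, upperGradient u x ^ p) := by
        gcongr
        exact hu.poincare_cubeC hp.le z hr
    _ = _ := by
        have : ℓ⁻¹ ^ p * ENNReal.ofReal (√n * (2 * r)) ^ p = ENNReal.ofReal √n ^ p := by
          rw [← ENNReal.mul_rpow_of_nonneg _ _ hp0.le, ENNReal.ofReal_mul (by positivity), ← hℓ,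
            mul_comm (ENNReal.ofReal √n), ← mul_assoc, ENNReal.inv_mul_cancel hℓ0 hℓt, one_mul]
        rw [hK, ← this]; ring

end SobolevPoincare

section DyadicCells

variable {n : ℕ}

/-- The multi-index of the `k`-th generation dyadic subcube of the grid generated by `CubeC z r`
that contains `x`. -/
def dyadicIndex (z : Rn n) (r : ℝ) (k : ℕ) (x : Rn n) : Fin n → ℤ :=
  fun i => ⌊(x i - (z i - r)) / (2 * r) * 2 ^ k⌋

/-- The `k`-th generation dyadic cube of the grid generated by `CubeC z r` that contains `x`. -/
def dyadicCell (z : Rn n) (r : ℝ) (k : ℕ) (x : Rn n) : Set (Rn n) :=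
  {y | dyadicIndex z r k y = dyadicIndex z r k x}

/-- The midpoint of `dyadicCell z r k x`. -/
def dyadicCenter (z : Rn n) (r : ℝ) (k : ℕ) (x : Rn n) : Rn n :=
  WithLp.toLp 2 fun i => z i - r + (2 * dyadicIndex z r k x i + 1) * (r / 2 ^ k)

variable {z : Rn n} {r : ℝ}

lemma mem_dyadicCell_self (k : ℕ) (x : Rn n) : x ∈ dyadicCell z r k x := rfl

lemma dyadicCell_eq_cubeC (hr : 0 < r) (k : ℕ) (x : Rn n) :
    dyadicCell z r k x = CubeC (dyadicCenter z r k x) (r / 2 ^ k) := by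
  ext y
  simp only [dyadicCell, CubeC, dyadicCenter, mem_ofPred_eq]
  rw [funext_iff]
  refine forall_congr' fun i => ?_
  have h2 : (0 : ℝ) < 2 ^ k := by positivity
  generalize dyadicIndex z r k x i = m
  simp only [dyadicIndex]
  rw [Int.floor_eq_iff]
  have e : (y i - (z i - r)) / (2 * r) * 2 ^ k = (y i - (z i - r)) / (2 * (r / 2 ^ k)) := by
    field_simp
  have hρ : 0 < 2 * (r / 2 ^ k) := by positivity
  rw [e, le_div_iff₀ hρ, div_lt_iff₀ hρ]
  constructor
  · rintro ⟨h, h'⟩; constructor <;> linarith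
  · rintro ⟨h, h'⟩; constructor <;> linarith

lemma dyadicIndex_zero_eq (hr : 0 < r) (x : Rn n) : dyadicIndex z r 0 x = 0 ↔ x ∈ CubeC z r := by
  rw [funext_iff]
  refine forall_congr' fun i => ?_
  simp only [dyadicIndex, Pi.zero_apply]
  rw [Int.floor_eq_iff, pow_zero, mul_one, le_div_iff₀ (by positivity),
    div_lt_iff₀ (by positivity)]
  push_cast
  constructor
  · rintro ⟨h, h'⟩; constructor <;> linarith
  · rintro ⟨h, h'⟩; constructor <;> linarith

lemma dyadicIndex_of_le {j k : ℕ} (hjk : j ≤ k) {x y : Rn n}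
    (h : dyadicIndex z r k x = dyadicIndex z r k y) :
    dyadicIndex z r j x = dyadicIndex z r j y := by
  obtain ⟨l, rfl⟩ := Nat.exists_eq_add_of_le hjk
  have key : ∀ w : Rn n, ∀ i,
      dyadicIndex z r j w i = dyadicIndex z r (j + l) w i / (2 ^ l : ℕ) := by
    intro w i
    simp only [dyadicIndex]
    rw [← Int.floor_div_natCast]
    congr 1
    push_cast
    rw [pow_add, ← mul_assoc, mul_div_assoc, div_self (by positivity), mul_one]
  ext i
  rw [key, key, h]

lemma dyadicCell_subset_of_le {j k : ℕ} (hjk : j ≤ k) (x : Rn n) :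
    dyadicCell z r k x ⊆ dyadicCell z r j x := fun _ hy => dyadicIndex_of_le hjk hy

lemma mem_cubeC_iff_of_mem_dyadicCell (hr : 0 < r) {k : ℕ} {x y : Rn n}
    (h : y ∈ dyadicCell z r k x) : y ∈ CubeC z r ↔ x ∈ CubeC z r := by
  rw [← dyadicIndex_zero_eq hr, ← dyadicIndex_zero_eq hr, dyadicIndex_of_le (Nat.zero_le k) h]

lemma dyadicCell_subset_cubeC (hr : 0 < r) (k : ℕ) {x : Rn n} (hx : x ∈ CubeC z r) :
    dyadicCell z r k x ⊆ CubeC z r := fun _ hy => (mem_cubeC_iff_of_mem_dyadicCell hr hy).2 hx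

lemma dyadicCell_zero (hr : 0 < r) {x : Rn n} (hx : x ∈ CubeC z r) :
    dyadicCell z r 0 x = CubeC z r := by
  refine (dyadicCell_subset_cubeC hr 0 hx).antisymm fun y hy => ?_
  exact ((dyadicIndex_zero_eq hr y).2 hy).trans ((dyadicIndex_zero_eq hr x).2 hx).symm

lemma dyadicCell_congr {k : ℕ} {x y : Rn n} (h : y ∈ dyadicCell z r k x) :
    dyadicCell z r k y = dyadicCell z r k x := by
  have h' : dyadicIndex z r k y = dyadicIndex z r k x := h
  simp only [dyadicCell, h']

lemma measurable_dyadicIndex (k : ℕ) : Measurable (dyadicIndex z r k) := by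
  refine measurable_pi_iff.2 fun i => ?_
  exact Int.measurable_floor.comp (by fun_prop)

lemma measurable_of_forall_mem_dyadicCell {β : Type*} [MeasurableSpace β] (k : ℕ) {H : Rn n → β}
    (hH : ∀ x, ∀ y ∈ dyadicCell z r k x, H y = H x) : Measurable H := by
  have : H = (Function.extend (dyadicIndex z r k) H fun _ => H 0) ∘ dyadicIndex z r k := by
    ext x
    simp only [Function.comp_apply]
    have hf : Function.FactorsThrough H (dyadicIndex z r k) := fun a b hab => hH b a hab
    rw [hf.extend_apply]
  rw [this]
  exact (measurable_of_countable _).comp (measurable_dyadicIndex k)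

lemma measurableSet_dyadicCell (k : ℕ) (x : Rn n) : MeasurableSet (dyadicCell z r k x) :=
  measurable_dyadicIndex k (measurableSet_singleton (dyadicIndex z r k x))

lemma measurableSet_of_forall_mem_dyadicCell (k : ℕ) {S : Set (Rn n)}
    (hS : ∀ x ∈ S, dyadicCell z r k x ⊆ S) : MeasurableSet S := by
  have : S = dyadicIndex z r k ⁻¹' (dyadicIndex z r k '' S) := by
    refine (subset_preimage_image _ _).antisymm ?_
    rintro y ⟨x, hx, hxy⟩
    exact hS x hx hxy.symm
  rw [this]
  exact measurable_dyadicIndex k (to_countable _).measurableSet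

/-- Inequalities between integrals over dyadic cells of a fixed generation can be summed. -/
lemma setLIntegral_le_of_dyadicCell (k : ℕ) {S : Set (Rn n)}
    (hS : ∀ x ∈ S, dyadicCell z r k x ⊆ S) {f g : Rn n → ℝ≥0∞}
    (h : ∀ x ∈ S, ∫⁻ y in dyadicCell z r k x, f y ≤ ∫⁻ y in dyadicCell z r k x, g y) :
    ∫⁻ y in S, f y ≤ ∫⁻ y in S, g y := by
  have hSm := measurableSet_of_forall_mem_dyadicCell k hS
  have hU : S = ⋃ m : Fin n → ℤ, S ∩ dyadicIndex z r k ⁻¹' {m} := by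
    ext x; simp
  have hm : ∀ m : Fin n → ℤ, MeasurableSet (S ∩ dyadicIndex z r k ⁻¹' {m}) := fun m =>
    hSm.inter (measurable_dyadicIndex k (measurableSet_singleton m))
  have hd : Pairwise (Function.onFun Disjoint fun m : Fin n → ℤ =>
      S ∩ dyadicIndex z r k ⁻¹' {m}) := by
    intro a b hab
    refine disjoint_left.2 ?_
    rintro x ⟨_, hx⟩ ⟨_, hx'⟩
    exact hab (hx.symm.trans hx')
  rw [hU, lintegral_iUnion hm hd, lintegral_iUnion hm hd]
  refine ENNReal.tsum_le_tsum fun m => ?_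
  rcases (S ∩ dyadicIndex z r k ⁻¹' {m}).eq_empty_or_nonempty with he | ⟨x, hxS, hx⟩
  · simp [he]
  · have : S ∩ dyadicIndex z r k ⁻¹' {m} = dyadicCell z r k x := by
      have hx' : dyadicIndex z r k x = m := hx
      subst hx'
      exact inter_eq_right.2 (hS x hxS)
    rw [this]
    exact h x hxS

end DyadicCells

/-- A scale invariant Poincaré inequality, for every exponent up to the Sobolev exponent. -/
theorem exists_poincare_cubeC_of_le (n : ℕ) {p q : ℝ} (hp : 1 < p) (hpq : p ≤ q) (hpn : p < n)
    (hq : q ≤ n * p / (n - p)) :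
    ∃ C : ℝ≥0∞, C ≠ ∞ ∧ ∀ (u : Rn n → ℝ) (L : ℝ≥0), LipschitzWith L u →
      ∀ (z : Rn n) (r : ℝ), 0 < r →
      ENNReal.ofReal r ^ (-(n : ℝ) + q / p * (n - p)) *
          ∫⁻ x in CubeC z r, ‖u x - ⨍ y in CubeC z r, u y‖ₑ ^ q ≤
        C * (∫⁻ x in CubeC z r, upperGradient u x ^ p) ^ (q / p) := by
  have hp0 : 0 < p := by linarith
  have hq0 : 0 < q := by linarith
  have hnp : 0 < (n : ℝ) - p := by linarith
  have hn0 : 0 < (n : ℝ) := by linarith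
  obtain ⟨C, hC, hSP⟩ := exists_sobolev_poincare_cubeC n hp hpn
  set s : ℝ := n * p / (n - p) with hs
  have hs0 : 0 < s := by positivity
  set γ : ℝ := -(n : ℝ) + q / p * (n - p) with hγ
  have hγs : n * (1 - q / s) = -γ := by rw [hγ, hs]; field_simp; ring
  have hqs : q / s ≤ 1 := by rw [div_le_one hs0]; exact hq
  refine ⟨2 ^ (-γ) * C ^ (q / s), ?_, ?_⟩
  · refine ENNReal.mul_ne_top (ENNReal.rpow_ne_top_of_ne_zero (by simp) (by simp)) ?_
    exact ENNReal.rpow_ne_top_of_nonneg (by positivity) hC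
  intro u L hu z r hr
  set Q := CubeC z r with hQ
  set c := ⨍ y in Q, u y with hc
  have hum := hu.continuous.measurable
  have hR0 : ENNReal.ofReal r ≠ 0 := by simp [hr]
  have hRt : ENNReal.ofReal r ≠ ∞ := ENNReal.ofReal_ne_top
  have h1 := lintegral_rpow_le (μ := volume.restrict Q) (p := s / q) (f := fun x => ‖u x - c‖ₑ ^ q)
    (by rw [le_div_iff₀ hq0]; linarith) (by fun_prop)
  have h2 : ∫⁻ x in Q, ‖u x - c‖ₑ ^ q ≤
      volume Q ^ (1 - q / s) * (∫⁻ x in Q, ‖u x - c‖ₑ ^ s) ^ (q / s) := by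
    have h3 := ENNReal.rpow_le_rpow h1 (by positivity : 0 ≤ q / s)
    rw [← ENNReal.rpow_mul, ENNReal.mul_rpow_of_nonneg _ _ (by positivity), ← ENNReal.rpow_mul,
      show s / q * (q / s) = 1 by field_simp, ENNReal.rpow_one,
      show (s / q - 1) * (q / s) = 1 - q / s by field_simp, Measure.restrict_apply_univ] at h3
    refine h3.trans_eq ?_
    congr 3
    ext x
    rw [← ENNReal.rpow_mul]
    congr 1
    field_simp
  have h4 : volume Q ^ (1 - q / s) = 2 ^ (-γ) * ENNReal.ofReal r ^ (-γ) := by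
    rw [hQ, volume_cubeC, ← ENNReal.rpow_natCast, ← ENNReal.rpow_mul, hγs,
      ENNReal.ofReal_mul (by norm_num), ENNReal.ofReal_ofNat,
      ENNReal.mul_rpow_of_ne_top (by simp) hRt]
  calc ENNReal.ofReal r ^ γ * ∫⁻ x in Q, ‖u x - c‖ₑ ^ q
      ≤ ENNReal.ofReal r ^ γ * ((2 ^ (-γ) * ENNReal.ofReal r ^ (-γ)) *
        (C * (∫⁻ x in Q, upperGradient u x ^ p) ^ ((n : ℝ) / (n - p))) ^ (q / s)) := by
        gcongr
        rw [← h4]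
        refine h2.trans ?_
        gcongr
        exact hSP u L hu z r hr
    _ = (ENNReal.ofReal r ^ γ * ENNReal.ofReal r ^ (-γ)) * (2 ^ (-γ) * C ^ (q / s) *
        (∫⁻ x in Q, upperGradient u x ^ p) ^ (q / p)) := by
        rw [ENNReal.mul_rpow_of_nonneg _ _ (by positivity), ← ENNReal.rpow_mul,
          show (n : ℝ) / (n - p) * (q / s) = q / p by rw [hs]; field_simp]
        ring
    _ = _ := by
        rw [← ENNReal.rpow_add _ _ hR0 hRt, add_neg_cancel, ENNReal.rpow_zero, one_mul]

lemma ENNReal.sum_range_succ_le_of_le_mul {a : ℕ → ℝ≥0∞} {t : ℝ≥0∞} (ht : t < 1)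
    (ha : ∀ k, a k ≤ t * a (k + 1)) (m : ℕ) :
    ∑ k ∈ Finset.range (m + 1), a k ≤ (1 - t)⁻¹ * a m := by
  have h0 : 1 - t ≠ 0 := by simpa [tsub_eq_zero_iff_le] using ht
  have hid : (1 - t)⁻¹ * t + 1 = (1 - t)⁻¹ := by
    nth_rewrite 2 [← ENNReal.inv_mul_cancel h0 (by simp)]
    rw [← mul_add, add_tsub_cancel_of_le ht.le, mul_one]
  induction m with
  | zero =>
    simp only [zero_add, Finset.sum_range_one]
    refine le_mul_of_one_le_left' ?_
    rw [← hid]; exact le_add_self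
  | succ m ih =>
    rw [Finset.sum_range_succ]
    calc _ ≤ (1 - t)⁻¹ * (t * a (m + 1)) + a (m + 1) := by
          gcongr
          exact ih.trans (by gcongr; exact ha m)
      _ = ((1 - t)⁻¹ * t + 1) * a (m + 1) := by ring
      _ = _ := by rw [hid]

/-- A sequence whose tails are comparable to their first terms decays geometrically. -/
lemma ENNReal.le_mul_pow_of_tsum_le {a : ℕ → ℝ≥0∞} {A : ℝ≥0∞} (hA : 1 < A) (hAt : A ≠ ∞)
    (ha : ∀ i, ∑' k, a (i + k) ≤ A * a i) (k : ℕ) :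
    a k ≤ A * (1 - A⁻¹) ^ k * a 0 := by
  have hA0 : A ≠ 0 := (zero_lt_one.trans hA).ne'
  have hθ : 1 - A⁻¹ ≠ 0 := by
    simpa [tsub_eq_zero_iff_le] using hA
  rcases eq_or_ne (a 0) ∞ with h0 | h0
  · rw [h0, ENNReal.mul_top (mul_ne_zero hA0 (pow_ne_zero _ hθ))]
    exact le_top
  set T : ℕ → ℝ≥0∞ := fun i => ∑' k, a (i + k) with hT
  have hsucc : ∀ i, T i = a i + T (i + 1) := by
    intro i
    simp only [hT]
    rw [tsum_eq_zero_add' ENNReal.summable]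
    simp only [add_zero]
    congr 2
    ext k
    congr 1; ring
  have hT0 : T 0 ≠ ∞ := ne_top_of_le_ne_top (ENNReal.mul_ne_top hAt h0) (ha 0)
  have hTt : ∀ i, T i ≠ ∞ := by
    intro i
    induction i with
    | zero => exact hT0
    | succ i ih => exact ne_top_of_le_ne_top ih (by rw [hsucc i]; exact le_add_self)
  have hstep : ∀ i, T (i + 1) ≤ (1 - A⁻¹) * T i := by
    intro i
    have h1 : A⁻¹ * T i ≤ a i := by
      rw [mul_comm, ← div_eq_mul_inv]
      exact ENNReal.div_le_of_le_mul' (ha i)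
    have hfin : A⁻¹ * T i ≠ ∞ := ENNReal.mul_ne_top (by simpa using hA0) (hTt i)
    rw [← ENNReal.add_le_add_iff_left hfin]
    calc A⁻¹ * T i + T (i + 1) ≤ a i + T (i + 1) := by gcongr
      _ = T i := (hsucc i).symm
      _ = A⁻¹ * T i + (1 - A⁻¹) * T i := by
        rw [← add_mul, add_tsub_cancel_of_le (ENNReal.inv_le_one.2 hA.le), one_mul]
  have hpow : T k ≤ (1 - A⁻¹) ^ k * T 0 := by
    induction k with
    | zero => simp
    | succ k ih =>
      refine (hstep k).trans ?_
      rw [pow_succ', mul_assoc]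
      gcongr
  calc a k ≤ T k := by rw [hsucc k]; exact le_self_add
    _ ≤ (1 - A⁻¹) ^ k * (A * a 0) := hpow.trans (by gcongr; exact ha 0)
    _ = _ := by ring

lemma ENNReal.rpow_le_rpow_of_nonpos {a b : ℝ≥0∞} {t : ℝ} (ht : t ≤ 0) (hab : a ≤ b) :
    b ^ t ≤ a ^ t := by
  rw [← neg_neg t, ENNReal.rpow_neg b, ENNReal.rpow_neg a, ENNReal.inv_le_inv]
  exact ENNReal.rpow_le_rpow hab (by linarith)

section NearSets

variable {n : ℕ}

/-- Half the side length of the `k`-th generation dyadic subcubes of a cube `CubeC z r`. -/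
def dyadicSize (r : ℝ) (k : ℕ) : ℝ≥0∞ := ENNReal.ofReal (r / 2 ^ k)

lemma dyadicSize_ne_zero {r : ℝ} (hr : 0 < r) (k : ℕ) : dyadicSize r k ≠ 0 := by
  simp only [dyadicSize, ne_eq, ENNReal.ofReal_eq_zero, not_le]
  positivity

lemma dyadicSize_ne_top (r : ℝ) (k : ℕ) : dyadicSize r k ≠ ∞ := ENNReal.ofReal_ne_top

lemma dyadicSize_eq_two_mul (r : ℝ) (k : ℕ) : dyadicSize r k = 2 * dyadicSize r (k + 1) := by
  rw [dyadicSize, dyadicSize, ← ENNReal.ofReal_ofNat 2, ← ENNReal.ofReal_mul (by norm_num)]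
  congr 1
  rw [pow_succ]; field_simp

variable {z : Rn n} {r : ℝ}

lemma volume_dyadicCell (hr : 0 < r) (k : ℕ) (x : Rn n) :
    volume (dyadicCell z r k x) = (2 * dyadicSize r k) ^ n := by
  rw [dyadicCell_eq_cubeC hr, volume_cubeC, ENNReal.ofReal_mul (by norm_num), dyadicSize,
    ENNReal.ofReal_ofNat]

lemma volume_dyadicCell_ne_zero (hr : 0 < r) (k : ℕ) (x : Rn n) :
    volume (dyadicCell z r k x) ≠ 0 := by
  rw [volume_dyadicCell hr]
  exact pow_ne_zero _ (mul_ne_zero (by simp) (dyadicSize_ne_zero hr k))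

lemma volume_dyadicCell_ne_top (hr : 0 < r) (k : ℕ) (x : Rn n) :
    volume (dyadicCell z r k x) ≠ ∞ := by
  rw [volume_dyadicCell hr]
  exact ENNReal.pow_ne_top (ENNReal.mul_ne_top (by simp) (dyadicSize_ne_top r k))

/-- The Aikawa condition with exponent `γ` and constant `C` for the set `E`. -/
def AikawaCondition (E : Set (Rn n)) (γ : ℝ) (C : ℝ≥0∞) : Prop :=
  ∀ e ∈ E, ∀ s : ℝ, 0 < s →
    ∫⁻ x in CubeC e s, distWeight E γ x ≤ C * ENNReal.ofReal s ^ γ * volume (CubeC e s)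

/-- The union of those `k`-th generation dyadic subcubes of `CubeC z r` whose distance to `E` is
less than half of their side length. -/
def nearSet (E : Set (Rn n)) (z : Rn n) (r : ℝ) (k : ℕ) : Set (Rn n) :=
  {x | x ∈ CubeC z r ∧ ∃ y ∈ dyadicCell z r k x, Metric.infDist y E < r / 2 ^ k}

variable {E : Set (Rn n)} {γ : ℝ} {C : ℝ≥0∞}

lemma nearSet_subset (k : ℕ) : nearSet E z r k ⊆ CubeC z r := fun _ hx => hx.1

lemma dyadicCell_subset_nearSet (hr : 0 < r) {k : ℕ} {x : Rn n} (hx : x ∈ nearSet E z r k) :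
    dyadicCell z r k x ⊆ nearSet E z r k := by
  intro y hy
  refine ⟨dyadicCell_subset_cubeC hr k hx.1 hy, ?_⟩
  rw [dyadicCell_congr hy]
  exact hx.2

lemma nearSet_antitone (hr : 0 < r) : Antitone (nearSet E z r) := by
  intro j k hjk x hx
  obtain ⟨hxQ, y, hy, hd⟩ := hx
  refine ⟨hxQ, y, dyadicCell_subset_of_le hjk x hy, hd.trans_le ?_⟩
  gcongr
  norm_num

lemma measurableSet_nearSet (hr : 0 < r) (k : ℕ) : MeasurableSet (nearSet E z r k) :=
  measurableSet_of_forall_mem_dyadicCell k fun _ hx => dyadicCell_subset_nearSet hr hx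

lemma abs_sub_lt_of_mem_dyadicCell (hr : 0 < r) {k : ℕ} {x y : Rn n}
    (hy : y ∈ dyadicCell z r k x) (i : Fin n) : |x i - y i| < 2 * (r / 2 ^ k) := by
  have hx := mem_dyadicCell_self (z := z) (r := r) k x
  rw [dyadicCell_eq_cubeC hr] at hx hy
  have h1 := hx i
  have h2 := hy i
  rw [abs_lt]
  constructor <;> linarith

lemma ofReal_infDist_le_of_mem_nearSet (hr : 0 < r) {k : ℕ} {x : Rn n}
    (hx : x ∈ nearSet E z r k) :
    ENNReal.ofReal (Metric.infDist x E) ≤ ENNReal.ofReal (1 + 2 * √n) * dyadicSize r k := by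
  obtain ⟨-, y, hy, hd⟩ := hx
  have hρ : 0 < r / 2 ^ k := by positivity
  rw [dyadicSize, ← ENNReal.ofReal_mul (by positivity)]
  refine ENNReal.ofReal_le_ofReal ?_
  have h1 : dist x y ≤ √n * (2 * (r / 2 ^ k)) := by
    rw [dist_eq_norm]
    exact norm_le_sqrt_mul (by positivity) fun i => (abs_sub_lt_of_mem_dyadicCell hr hy i).le
  have h2 := Metric.infDist_le_infDist_add_dist (x := x) (y := y) (s := E)
  linarith

lemma setLIntegral_distWeight_dyadicCell_le (hr : 0 < r) (hE : E.Nonempty)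
    (hA : AikawaCondition E γ C) {k : ℕ} {x : Rn n} (hx : x ∈ nearSet E z r k) :
    ∫⁻ y in dyadicCell z r k x, distWeight E γ y ≤
      C * 4 ^ γ * 4 ^ n * dyadicSize r k ^ γ * volume (dyadicCell z r k x) := by
  obtain ⟨-, y, hy, hd⟩ := hx
  obtain ⟨e, he, hye⟩ := (Metric.infDist_lt_iff hE).1 hd
  have hρ : 0 < r / 2 ^ k := by positivity
  have hsub : dyadicCell z r k x ⊆ CubeC e (4 * (r / 2 ^ k)) := by
    intro v hv i
    rw [← dyadicCell_congr hy] at hv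
    have h1 := abs_lt.1 (abs_sub_lt_of_mem_dyadicCell hr hv i)
    have h2 : |y i - e i| ≤ dist y e := by
      rw [dist_eq_norm]
      exact PiLp.norm_apply_le (y - e) i
    have h3 := abs_le.1 h2
    constructor <;> linarith
  refine (lintegral_mono_set hsub).trans ((hA e he _ (by positivity)).trans_eq ?_)
  have h4 : ENNReal.ofReal (4 * (r / 2 ^ k)) = 4 * dyadicSize r k := by
    rw [ENNReal.ofReal_mul (by norm_num), ENNReal.ofReal_ofNat, dyadicSize]
  rw [volume_dyadicCell hr, volume_cubeC, h4, ENNReal.ofReal_mul zero_le_two, ENNReal.ofReal_ofNat,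
    h4, ENNReal.mul_rpow_of_ne_top (by simp) (dyadicSize_ne_top r k)]
  simp only [mul_pow]
  ring

lemma distWeight_le_of_notMem_nearSet (hγ : γ ≤ 0) {k : ℕ} {x : Rn n}
    (hxQ : x ∈ CubeC z r) (hx : x ∉ nearSet E z r k) :
    distWeight E γ x ≤ dyadicSize r k ^ γ := by
  have h : r / 2 ^ k ≤ Metric.infDist x E := by
    by_contra! h
    exact hx ⟨hxQ, x, mem_dyadicCell_self k x, h⟩
  exact ENNReal.rpow_le_rpow_of_nonpos hγ (ENNReal.ofReal_le_ofReal h)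

lemma measurable_distWeight : Measurable (distWeight E γ) := by
  unfold distWeight
  exact ((Metric.continuous_infDist_pt E).measurable.ennreal_ofReal).pow_const _

lemma distWeight_ne_zero (hγ : γ ≤ 0) (x : Rn n) : distWeight E γ x ≠ 0 := by
  rw [distWeight, ne_eq, ENNReal.rpow_eq_zero_iff]
  rintro (⟨-, h⟩ | ⟨h, -⟩)
  · linarith
  · exact ENNReal.ofReal_ne_top h

lemma two_rpow_lt_one (hγ : γ < 0) : (2 : ℝ≥0∞) ^ γ < 1 :=
  ENNReal.rpow_lt_one_of_one_lt_of_neg (by norm_num) hγ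

/-- Along the dyadic cubes close to `E` which contain a given point, negative powers of the side
lengths add up to a multiple of the distance weight. -/
lemma tsum_indicator_nearSet_le (hr : 0 < r) (hγ : γ < 0) (x : Rn n) :
    ∑' k, (nearSet E z r k).indicator (fun _ => dyadicSize r k ^ γ) x ≤
      (1 - 2 ^ γ)⁻¹ * ENNReal.ofReal (1 + 2 * √n) ^ (-γ) * distWeight E γ x := by
  rw [ENNReal.tsum_eq_iSup_nat]
  refine iSup_le fun m => ?_
  induction m with
  | zero => simp
  | succ m ih =>
    by_cases hx : x ∈ nearSet E z r m
    · calc ∑ k ∈ Finset.range (m + 1),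
            (nearSet E z r k).indicator (fun _ => dyadicSize r k ^ γ) x
          ≤ ∑ k ∈ Finset.range (m + 1), dyadicSize r k ^ γ :=
            Finset.sum_le_sum fun k _ => indicator_le_self _ _ _
        _ ≤ (1 - 2 ^ γ)⁻¹ * dyadicSize r m ^ γ := by
            refine ENNReal.sum_range_succ_le_of_le_mul (two_rpow_lt_one hγ) (fun k => ?_) m
            rw [dyadicSize_eq_two_mul r k,
              ENNReal.mul_rpow_of_ne_top (by simp) (dyadicSize_ne_top r _)]
        _ ≤ _ := by
            rw [mul_assoc]
            gcongr
            set K := ENNReal.ofReal (1 + 2 * √n)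
            have hK0 : K ≠ 0 := by
              simp only [K, ne_eq, ENNReal.ofReal_eq_zero, not_le]; positivity
            have hKt : K ≠ ∞ := ENNReal.ofReal_ne_top
            calc dyadicSize r m ^ γ = K ^ (-γ) * (K * dyadicSize r m) ^ γ := by
                  rw [ENNReal.mul_rpow_of_ne_top hKt (dyadicSize_ne_top r _), ← mul_assoc,
                    ← ENNReal.rpow_add _ _ hK0 hKt, neg_add_cancel, ENNReal.rpow_zero, one_mul]
              _ ≤ _ := by
                  gcongr
                  exact ENNReal.rpow_le_rpow_of_nonpos hγ.le
                    (ofReal_infDist_le_of_mem_nearSet hr hx)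
    · rw [Finset.sum_range_succ, indicator_of_notMem hx, add_zero]
      exact ih

/-- The constant in `tsum_indicator_nearSet_le`. -/
def nearConst (n : ℕ) (γ : ℝ) : ℝ≥0∞ := (1 - 2 ^ γ)⁻¹ * ENNReal.ofReal (1 + 2 * √n) ^ (-γ)

lemma nearConst_ne_top (n : ℕ) (hγ : γ < 0) : nearConst n γ ≠ ∞ := by
  refine ENNReal.mul_ne_top ?_ (ENNReal.rpow_ne_top_of_nonneg (by linarith) (by simp))
  simpa [tsub_eq_zero_iff_le] using two_rpow_lt_one hγ

lemma tsum_setLIntegral_nearSet_le (hr : 0 < r) (hγ : γ < 0) (i : ℕ) {f : Rn n → ℝ≥0∞}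
    (hf : Measurable f) :
    ∑' k, dyadicSize r (i + k) ^ γ * ∫⁻ x in nearSet E z r (i + k), f x ≤
      nearConst n γ * ∫⁻ x in nearSet E z r i, f x * distWeight E γ x := by
  have hm := fun k => measurableSet_nearSet (E := E) (z := z) hr k
  have h1 : ∀ k, dyadicSize r (i + k) ^ γ * ∫⁻ x in nearSet E z r (i + k), f x =
      ∫⁻ x in nearSet E z r i,
        (nearSet E z r (i + k)).indicator (fun _ => dyadicSize r (i + k) ^ γ) x * f x := by
    intro k
    have : ∀ x, (nearSet E z r (i + k)).indicator (fun _ => dyadicSize r (i + k) ^ γ) x * f x =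
        (nearSet E z r (i + k)).indicator (fun x => dyadicSize r (i + k) ^ γ * f x) x := by
      intro x
      by_cases hx : x ∈ nearSet E z r (i + k) <;> simp [hx]
    simp only [this]
    rw [setLIntegral_indicator (hm _), inter_eq_left.2 (nearSet_antitone hr (Nat.le_add_right i k)),
      lintegral_const_mul _ hf]
  simp only [h1]
  have hmeas : ∀ k, Measurable fun x =>
      (nearSet E z r (i + k)).indicator (fun _ => dyadicSize r (i + k) ^ γ) x * f x :=
    fun k => (measurable_const.indicator (hm _)).mul hf
  rw [← lintegral_tsum fun k => (hmeas k).aemeasurable,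
    ← lintegral_const_mul _ (by exact hf.mul measurable_distWeight)]
  refine lintegral_mono fun x => ?_
  simp only
  rw [ENNReal.tsum_mul_right]
  calc _ ≤ (nearConst n γ * distWeight E γ x) * f x := by
        gcongr
        refine (ENNReal.tsum_comp_le_tsum_of_injective (add_right_injective i)
          (fun k => (nearSet E z r k).indicator (fun _ => dyadicSize r k ^ γ) x)).trans ?_
        exact tsum_indicator_nearSet_le hr hγ x
    _ = _ := by ring

/-- Integrals over the sets close to `E` of functions constant on dyadic cubes decay. -/
lemma setLIntegral_nearSet_decay (hr : 0 < r) (hγ : γ < 0) (hE : E.Nonempty)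
    (hA : AikawaCondition E γ C) (hC : C ≠ ∞) {j : ℕ} {H : Rn n → ℝ≥0∞}
    (hH : ∀ x, ∀ y ∈ dyadicCell z r j x, H y = H x) {A : ℝ≥0∞}
    (hAdef : A = nearConst n γ * (C * 4 ^ γ * 4 ^ n) + 2) (k : ℕ) :
    dyadicSize r (j + k) ^ γ * ∫⁻ x in nearSet E z r (j + k), H x ≤
      A * (1 - A⁻¹) ^ k * (dyadicSize r j ^ γ * ∫⁻ x in nearSet E z r j, H x) := by
  have hHm : Measurable H := measurable_of_forall_mem_dyadicCell j hH
  have hA1 : 1 < A := by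
    rw [hAdef]
    exact lt_of_lt_of_le (by norm_num) le_add_self
  have hAt : A ≠ ∞ := by
    rw [hAdef]
    refine ENNReal.add_ne_top.2 ⟨ENNReal.mul_ne_top (nearConst_ne_top n hγ) ?_, by simp⟩
    refine ENNReal.mul_ne_top (ENNReal.mul_ne_top hC ?_) (by simp)
    exact ENNReal.rpow_ne_top_of_ne_zero (by simp) (by simp)
  refine ENNReal.le_mul_pow_of_tsum_le
    (a := fun k => dyadicSize r (j + k) ^ γ * ∫⁻ x in nearSet E z r (j + k), H x)
    hA1 hAt (fun i => ?_) k
  simp only [← add_assoc]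
  refine (tsum_setLIntegral_nearSet_le hr hγ (j + i) hHm).trans ?_
  set C' := C * 4 ^ γ * 4 ^ n with hC'
  have hcell : ∫⁻ x in nearSet E z r (j + i), H x * distWeight E γ x ≤
      ∫⁻ x in nearSet E z r (j + i), H x * (C' * dyadicSize r (j + i) ^ γ) := by
    refine setLIntegral_le_of_dyadicCell (j + i) (fun x hx => dyadicCell_subset_nearSet hr hx) ?_
    intro x hx
    have hcongr : ∀ g : Rn n → ℝ≥0∞, Measurable g → ∫⁻ y in dyadicCell z r (j + i) x, H y * g y =
        H x * ∫⁻ y in dyadicCell z r (j + i) x, g y := by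
      intro g hg
      rw [← lintegral_const_mul _ hg]
      refine setLIntegral_congr_fun (measurableSet_dyadicCell _ _) fun y hy => ?_
      rw [hH x y (dyadicCell_subset_of_le (Nat.le_add_right j i) x hy)]
    rw [hcongr _ measurable_distWeight, hcongr _ measurable_const, setLIntegral_const]
    gcongr
    exact setLIntegral_distWeight_dyadicCell_le hr hE hA hx
  rw [lintegral_mul_const _ hHm, mul_comm] at hcell
  calc nearConst n γ * ∫⁻ x in nearSet E z r (j + i), H x * distWeight E γ x
      ≤ nearConst n γ * (C' * dyadicSize r (j + i) ^ γ * ∫⁻ x in nearSet E z r (j + i), H x) := by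
        gcongr
    _ = nearConst n γ * C' * (dyadicSize r (j + i) ^ γ * ∫⁻ x in nearSet E z r (j + i), H x) := by
        ring
    _ ≤ _ := by
        gcongr
        rw [hAdef]; exact le_self_add

end NearSets

section DyadicAverages

variable {n : ℕ} {z : Rn n} {r : ℝ} {E : Set (Rn n)} {γ : ℝ} {C : ℝ≥0∞}

/-- The average of `f` over the `k`-th generation dyadic cube which contains `x`. -/
def dyadicAverage (z : Rn n) (r : ℝ) (k : ℕ) (f : Rn n → ℝ≥0∞) (x : Rn n) : ℝ≥0∞ :=
  (volume (dyadicCell z r k x))⁻¹ * ∫⁻ y in dyadicCell z r k x, f y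

lemma dyadicAverage_congr {k : ℕ} {f : Rn n → ℝ≥0∞} {x y : Rn n} (hy : y ∈ dyadicCell z r k x) :
    dyadicAverage z r k f y = dyadicAverage z r k f x := by
  simp only [dyadicAverage, dyadicCell_congr hy]

lemma measurable_dyadicAverage (k : ℕ) (f : Rn n → ℝ≥0∞) :
    Measurable (dyadicAverage z r k f) :=
  measurable_of_forall_mem_dyadicCell k fun _ _ hy => dyadicAverage_congr hy

lemma setLIntegral_dyadicAverage_rpow_le (hr : 0 < r) (hγ : γ < 0) (hE : E.Nonempty)
    (hA : AikawaCondition E γ C) (hC : C ≠ ∞) {p : ℝ} (hp : 1 < p) {f : Rn n → ℝ≥0∞}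
    (hf : Measurable f) (k : ℕ) :
    ∫⁻ x in nearSet E z r k, dyadicAverage z r k f x ^ p ≤
      (C * 4 ^ γ * 4 ^ n) ^ (p - 1) * (dyadicSize r k ^ (γ * (p - 1)) *
        ∫⁻ x in nearSet E z r k, f x ^ p * distWeight E γ x ^ (1 - p)) := by
  have hp1 : 0 ≤ p - 1 := by linarith
  have hwm := measurable_distWeight (E := E) (γ := γ)
  have hgm : Measurable fun x => f x ^ p * distWeight E γ x ^ (1 - p) :=
    (hf.pow_const _).mul (hwm.pow_const _)
  set C' := C * 4 ^ γ * 4 ^ n with hC'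
  have hCt : C' ≠ ∞ := by
    refine ENNReal.mul_ne_top (ENNReal.mul_ne_top hC ?_) (by simp)
    exact ENNReal.rpow_ne_top_of_ne_zero (by simp) (by simp)
  rw [← mul_assoc, ← lintegral_const_mul _ hgm]
  refine setLIntegral_le_of_dyadicCell k (fun x hx => dyadicCell_subset_nearSet hr hx) ?_
  intro x hx
  set D := dyadicCell z r k x with hD
  have hDm : MeasurableSet D := measurableSet_dyadicCell k x
  have hV0 : volume D ≠ 0 := volume_dyadicCell_ne_zero hr k x
  have hVt : volume D ≠ ∞ := volume_dyadicCell_ne_top hr k x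
  have hwD := setLIntegral_distWeight_dyadicCell_le hr hE hA hx
  rw [← hC', ← hD] at hwD
  have hρ : dyadicSize r k ^ γ ≠ ∞ :=
    ENNReal.rpow_ne_top_of_ne_zero (dyadicSize_ne_zero hr k) (dyadicSize_ne_top r k)
  have hwt : ∫⁻ y in D, distWeight E γ y ≠ ∞ :=
    ne_top_of_le_ne_top (ENNReal.mul_ne_top (ENNReal.mul_ne_top hCt hρ) hVt) hwD
  have hH := lintegral_rpow_le_weighted (μ := volume.restrict D) hp.le hf.aemeasurable
    hwm.aemeasurable (.of_forall fun y => distWeight_ne_zero hγ.le y)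
    ((ae_lt_top hwm hwt).mono fun y hy => hy.ne)
  have hconst : ∫⁻ y in D, dyadicAverage z r k f y ^ p =
      ∫⁻ _ in D, ((volume D)⁻¹ * ∫⁻ y in D, f y) ^ p :=
    setLIntegral_congr_fun hDm fun y hy => by
      simp only [dyadicAverage_congr hy]; rfl
  rw [hconst, setLIntegral_const, lintegral_const_mul _ hgm,
    ENNReal.mul_rpow_of_nonneg _ _ (by linarith)]
  calc (volume D)⁻¹ ^ p * (∫⁻ y in D, f y) ^ p * volume D
      ≤ (volume D)⁻¹ ^ p * ((C' * dyadicSize r k ^ γ * volume D) ^ (p - 1) *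
        ∫⁻ y in D, f y ^ p * distWeight E γ y ^ (1 - p)) * volume D := by
        gcongr
        refine hH.trans ?_
        gcongr
    _ = ((volume D) ^ (-p) * (volume D ^ (p - 1) * volume D ^ (1 : ℝ))) *
        (C' ^ (p - 1) * dyadicSize r k ^ (γ * (p - 1)) *
        ∫⁻ y in D, f y ^ p * distWeight E γ y ^ (1 - p)) := by
        rw [ENNReal.mul_rpow_of_nonneg _ _ hp1, ENNReal.mul_rpow_of_nonneg _ _ hp1,
          ← ENNReal.rpow_mul, ENNReal.inv_rpow, ← ENNReal.rpow_neg, ENNReal.rpow_one]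
        ring
    _ = _ := by
        rw [← ENNReal.rpow_add _ _ hV0 hVt, ← ENNReal.rpow_add _ _ hV0 hVt,
          show -p + (p - 1 + 1) = 0 by ring, ENNReal.rpow_zero, one_mul]

/-- A Carleson embedding for the averages over the dyadic cubes close to `E`. -/
lemma tsum_setLIntegral_dyadicAverage_rpow_le (hr : 0 < r) (hγ : γ < 0) (hE : E.Nonempty)
    (hA : AikawaCondition E γ C) (hC : C ≠ ∞) {p : ℝ} (hp : 1 < p) {f : Rn n → ℝ≥0∞}
    (hf : Measurable f) :
    ∑' k, ∫⁻ x in nearSet E z r k, dyadicAverage z r k f x ^ p ≤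
      (C * 4 ^ γ * 4 ^ n) ^ (p - 1) * nearConst n (γ * (p - 1)) *
        ∫⁻ x in CubeC z r, f x ^ p := by
  have hwm := measurable_distWeight (E := E) (γ := γ)
  have hgm : Measurable fun x => f x ^ p * distWeight E γ x ^ (1 - p) :=
    (hf.pow_const _).mul (hwm.pow_const _)
  have hβ : γ * (p - 1) < 0 := mul_neg_of_neg_of_pos hγ (by linarith)
  refine (ENNReal.tsum_le_tsum fun k =>
    setLIntegral_dyadicAverage_rpow_le hr hγ hE hA hC hp hf k).trans ?_
  rw [ENNReal.tsum_mul_left, mul_assoc (_ ^ (p - 1))]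
  gcongr
  have h := tsum_setLIntegral_nearSet_le (E := E) (z := z) hr hβ 0 hgm
  simp only [zero_add] at h
  refine h.trans ?_
  refine mul_le_mul_right ?_ _
  refine (lintegral_mono fun x => ?_).trans (lintegral_mono_set (nearSet_subset 0))
  have h1 : distWeight E (γ * (p - 1)) x = (distWeight E γ x ^ (1 - p))⁻¹ := by
    rw [distWeight, distWeight, ← ENNReal.rpow_mul, ← ENNReal.rpow_neg]
    congr 1; ring
  rw [h1, mul_assoc]
  exact mul_le_of_le_one_right' (ENNReal.mul_inv_le_one _)

lemma dyadicAverage_rpow_le (hr : 0 < r) {p : ℝ} (hp : 1 ≤ p) {f : Rn n → ℝ≥0∞}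
    (hf : Measurable f) (k : ℕ) {x : Rn n} (hx : x ∈ CubeC z r) :
    dyadicAverage z r k f x ^ p ≤
      (volume (dyadicCell z r k x))⁻¹ * ∫⁻ y in CubeC z r, f y ^ p := by
  set D := dyadicCell z r k x with hD
  have hV0 : volume D ≠ 0 := volume_dyadicCell_ne_zero hr k x
  have hVt : volume D ≠ ∞ := volume_dyadicCell_ne_top hr k x
  have h := lintegral_rpow_le (μ := volume.restrict D) hp hf.aemeasurable
  rw [Measure.restrict_apply_univ] at h
  rw [dyadicAverage, ← hD, ENNReal.mul_rpow_of_nonneg _ _ (by linarith)]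
  calc (volume D)⁻¹ ^ p * (∫⁻ y in D, f y) ^ p
      ≤ (volume D)⁻¹ ^ p * (volume D ^ (p - 1) * ∫⁻ y in D, f y ^ p) := by gcongr
    _ = (volume D)⁻¹ * ∫⁻ y in D, f y ^ p := by
      rw [← mul_assoc, ENNReal.inv_rpow, ← ENNReal.rpow_neg, ← ENNReal.rpow_add _ _ hV0 hVt,
        show -p + (p - 1) = -1 by ring, ENNReal.rpow_neg_one]
    _ ≤ _ := by
      gcongr
      exact dyadicCell_subset_cubeC hr k hx

lemma dyadicSize_rpow_mul_dyadicAverage_rpow_le (hr : 0 < r) {p q : ℝ} (hp : 1 < p) (hpq : p ≤ q)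
    {f : Rn n → ℝ≥0∞} (hf : Measurable f) (k : ℕ) {x : Rn n} (hx : x ∈ CubeC z r) :
    dyadicSize r k ^ (-(n : ℝ) + q / p * (n - p)) *
        (dyadicSize r k * dyadicAverage z r k f x) ^ q ≤
      (∫⁻ y in CubeC z r, f y ^ p) ^ (q / p - 1) * dyadicAverage z r k f x ^ p := by
  have hp0 : 0 < p := by linarith
  set ρ := dyadicSize r k with hρ
  have hρ0 : ρ ≠ 0 := dyadicSize_ne_zero hr k
  have hρt : ρ ≠ ∞ := dyadicSize_ne_top r k
  set a := dyadicAverage z r k f x with ha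
  set S := ∫⁻ y in CubeC z r, f y ^ p with hS
  have hqp : 0 ≤ q / p - 1 := by rw [sub_nonneg, le_div_iff₀ hp0]; linarith
  have h1 : a ^ p ≤ (ρ ^ n)⁻¹ * S := by
    refine (dyadicAverage_rpow_le hr hp.le hf k hx).trans ?_
    rw [volume_dyadicCell hr]
    gcongr
    exact le_mul_of_one_le_left' one_le_two
  have h2 : a ^ q ≤ a ^ p * ((ρ ^ n)⁻¹ * S) ^ (q / p - 1) := by
    calc a ^ q = a ^ p * (a ^ p) ^ (q / p - 1) := by
          rw [← ENNReal.rpow_mul, ← ENNReal.rpow_add_of_nonneg _ _ hp0.le (by positivity)]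
          congr 1; field_simp; ring
      _ ≤ _ := by gcongr
  rw [ENNReal.mul_rpow_of_nonneg _ _ (by linarith)]
  calc ρ ^ (-(n : ℝ) + q / p * (n - p)) * (ρ ^ q * a ^ q)
      ≤ ρ ^ (-(n : ℝ) + q / p * (n - p)) * (ρ ^ q * (a ^ p * ((ρ ^ n)⁻¹ * S) ^ (q / p - 1))) := by
        gcongr
    _ = (ρ ^ (-(n : ℝ) + q / p * (n - p)) * ρ ^ q * ρ ^ (-(n * (q / p - 1)))) *
        (S ^ (q / p - 1) * a ^ p) := by
        rw [ENNReal.mul_rpow_of_nonneg _ _ hqp, ENNReal.inv_rpow, ← ENNReal.rpow_natCast,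
          ← ENNReal.rpow_mul, ← ENNReal.rpow_neg]
        ring
    _ = _ := by
        rw [← ENNReal.rpow_add _ _ hρ0 hρt, ← ENNReal.rpow_add _ _ hρ0 hρt,
          show -(n : ℝ) + q / p * (n - p) + q + -(n * (q / p - 1)) = 0 by field_simp; ring,
          ENNReal.rpow_zero, one_mul]

/-- The dimensional constant in `LipschitzWith.enorm_sub_average_cubeC_le`. -/
def chainConst (n : ℕ) : ℝ≥0∞ := 2 ^ n * 2 ^ n * ENNReal.ofReal (√n * 2)

variable {u : Rn n → ℝ} {L : ℝ≥0}

lemma LipschitzWith.enorm_average_succ_sub_le (hu : LipschitzWith L u) (hr : 0 < r) (k : ℕ)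
    (x : Rn n) :
    ‖(⨍ y in dyadicCell z r k x, u y) - ⨍ y in dyadicCell z r (k + 1) x, u y‖ₑ ≤
      chainConst n * (dyadicSize r k * dyadicAverage z r k (upperGradient u) x) := by
  set c := ⨍ y in dyadicCell z r k x, u y with hc
  have h1 : ‖c - ⨍ y in dyadicCell z r (k + 1) x, u y‖ₑ ≤
      (volume (dyadicCell z r (k + 1) x))⁻¹ * ∫⁻ y in dyadicCell z r (k + 1) x, ‖u y - c‖ₑ := by
    rw [dyadicCell_eq_cubeC hr (k + 1)]
    exact hu.enorm_sub_average_le _ (by positivity) c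
  have h2 : ∫⁻ y in dyadicCell z r k x, ‖u y - c‖ₑ ≤
      2 ^ n * (ENNReal.ofReal (√n * 2) * dyadicSize r k) *
        ∫⁻ y in dyadicCell z r k x, upperGradient u y := by
    have h := hu.poincare_cubeC le_rfl (dyadicCenter z r k x) (r := r / 2 ^ k) (by positivity)
    simp only [ENNReal.rpow_one] at h
    rw [← dyadicCell_eq_cubeC hr, ← mul_assoc, ENNReal.ofReal_mul (by positivity)] at h
    exact h
  have hv : (volume (dyadicCell z r (k + 1) x))⁻¹ = 2 ^ n * (volume (dyadicCell z r k x))⁻¹ := by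
    rw [volume_dyadicCell hr, volume_dyadicCell hr, dyadicSize_eq_two_mul r k,
      mul_pow 2 (2 * dyadicSize r (k + 1)), ENNReal.mul_inv (by simp) (by simp), ← mul_assoc,
      ENNReal.mul_inv_cancel (by simp) (by simp), one_mul]
  calc _ ≤ 2 ^ n * (volume (dyadicCell z r k x))⁻¹ *
        (2 ^ n * (ENNReal.ofReal (√n * 2) * dyadicSize r k) *
        ∫⁻ y in dyadicCell z r k x, upperGradient u y) := by
        refine h1.trans ?_
        rw [hv]
        gcongr
        exact (lintegral_mono_set (dyadicCell_subset_of_le k.le_succ x)).trans h2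
    _ = _ := by
        rw [chainConst, dyadicAverage]; ring

lemma LipschitzWith.enorm_sub_average_cubeC_le (hu : LipschitzWith L u) (hr : 0 < r) (k : ℕ)
    {x : Rn n} (hx : x ∈ CubeC z r) :
    ‖u x - ⨍ y in CubeC z r, u y‖ₑ ≤ ‖u x - ⨍ y in dyadicCell z r k x, u y‖ₑ +
      chainConst n *
        ∑ j ∈ Finset.range k, dyadicSize r j * dyadicAverage z r j (upperGradient u) x := by
  induction k with
  | zero => simp [dyadicCell_zero hr hx]
  | succ k ih =>
    refine ih.trans ?_
    rw [Finset.sum_range_succ, mul_add, ← add_assoc, add_right_comm]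
    gcongr
    calc ‖u x - ⨍ y in dyadicCell z r k x, u y‖ₑ
        = ‖(u x - ⨍ y in dyadicCell z r (k + 1) x, u y) -
          ((⨍ y in dyadicCell z r k x, u y) - ⨍ y in dyadicCell z r (k + 1) x, u y)‖ₑ := by
          congr 1; ring
      _ ≤ _ := enorm_sub_le.trans (by gcongr; exact hu.enorm_average_succ_sub_le hr k x)

end DyadicAverages

lemma ENNReal.sum_rpow_le_geometric {q : ℝ} (hq : 1 ≤ q) {τ : ℝ≥0∞} (hτ0 : τ ≠ 0) (hτ : τ ≠ ∞)
    (b : ℕ → ℝ≥0∞) (k : ℕ) :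
    (∑ j ∈ Finset.range (k + 1), b j) ^ q ≤
      (1 - τ)⁻¹ ^ (q - 1) * ∑ j ∈ Finset.range (k + 1), b j ^ q * (τ ^ (k - j)) ^ (1 - q) := by
  refine (sum_rpow_le_weighted hq (k + 1) b (fun j => τ ^ (k - j)) (fun j => pow_ne_zero _ hτ0)
    fun j => ENNReal.pow_ne_top hτ).trans ?_
  gcongr
  have := Finset.sum_range_reflect (fun j => τ ^ j) (k + 1)
  simp only [add_tsub_cancel_right] at this
  rw [this, ← ENNReal.tsum_geometric]
  exact ENNReal.sum_le_tsum _

lemma ENNReal.tsum_sum_range_succ_eq (f : ℕ → ℕ → ℝ≥0∞) :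
    ∑' k, ∑ j ∈ Finset.range (k + 1), f j (k - j) = ∑' j, ∑' l, f j l := by
  rw [← ENNReal.tsum_prod, ← Equiv.tsum_eq Finset.HasAntidiagonal.sigmaAntidiagonalEquivProd,
    ENNReal.tsum_sigma']
  refine tsum_congr fun k => ?_
  rw [tsum_fintype, ← Finset.Nat.sum_antidiagonal_eq_sum_range_succ f,
    ← Finset.sum_coe_sort]
  rfl

section Shells

variable {n : ℕ} {z : Rn n} {r : ℝ} {E : Set (Rn n)} {γ : ℝ} {C : ℝ≥0∞}

/-- The union of the dyadic subcubes of `CubeC z r` of generation `k` which are not close to `E`,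
but whose ancestors are. -/
def dyadicShell (E : Set (Rn n)) (z : Rn n) (r : ℝ) : ℕ → Set (Rn n)
  | 0 => CubeC z r \ nearSet E z r 0
  | k + 1 => nearSet E z r k \ nearSet E z r (k + 1)

lemma dyadicShell_subset (k : ℕ) : dyadicShell E z r k ⊆ CubeC z r \ nearSet E z r k := by
  cases k with
  | zero => exact subset_rfl
  | succ k => exact fun x hx => ⟨nearSet_subset k hx.1, hx.2⟩

lemma dyadicCell_subset_dyadicShell (hr : 0 < r) {k : ℕ} {x : Rn n}
    (hx : x ∈ dyadicShell E z r k) : dyadicCell z r k x ⊆ dyadicShell E z r k := by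
  have hnot : ∀ y ∈ dyadicCell z r k x, y ∉ nearSet E z r k := by
    intro y hy hyN
    have hxy : x ∈ dyadicCell z r k y := by
      rw [dyadicCell_congr hy]; exact mem_dyadicCell_self k x
    exact (dyadicShell_subset k hx).2 (dyadicCell_subset_nearSet hr hyN hxy)
  cases k with
  | zero => exact fun y hy => ⟨dyadicCell_subset_cubeC hr 0 hx.1 hy, hnot y hy⟩
  | succ k =>
    exact fun y hy => ⟨dyadicCell_subset_nearSet hr hx.1
      (dyadicCell_subset_of_le k.le_succ x hy), hnot y hy⟩

lemma measurableSet_dyadicShell (hr : 0 < r) (k : ℕ) : MeasurableSet (dyadicShell E z r k) :=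
  measurableSet_of_forall_mem_dyadicCell k fun _ hx => dyadicCell_subset_dyadicShell hr hx

lemma pairwise_disjoint_dyadicShell (hr : 0 < r) :
    Pairwise (Function.onFun Disjoint (dyadicShell E z r)) := by
  have key : ∀ j k, j < k → Disjoint (dyadicShell E z r j) (dyadicShell E z r k) := by
    intro j k hjk
    obtain ⟨k, rfl⟩ := Nat.exists_eq_succ_of_ne_zero (Nat.ne_zero_of_lt hjk)
    refine disjoint_left.2 fun x hxj hxk => ?_
    exact (dyadicShell_subset j hxj).2 (nearSet_antitone hr (Nat.lt_succ_iff.1 hjk) hxk.1)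
  intro j k hjk
  rcases hjk.lt_or_gt with h | h
  · exact key j k h
  · exact (key k j h).symm

lemma subset_iUnion_dyadicShell :
    CubeC z r ⊆ (⋃ k, dyadicShell E z r k) ∪ ⋂ k, nearSet E z r k := by
  intro x hx
  by_cases h : ∀ k, x ∈ nearSet E z r k
  · exact Or.inr (mem_iInter.2 h)
  · left
    push Not at h
    classical
    have hN := Nat.find_spec h
    rw [mem_iUnion]
    rcases hk : Nat.find h with _ | k
    · exact ⟨0, hx, by rw [← hk]; exact hN⟩
    · refine ⟨k + 1, ?_, by rw [← hk]; exact hN⟩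
      have := Nat.find_min h (m := k) (by omega)
      simpa using this

lemma volume_iInter_nearSet (hr : 0 < r) (hγ : γ < 0) (hE : E.Nonempty)
    (hA : AikawaCondition E γ C) (hC : C ≠ ∞) : volume (⋂ k, nearSet E z r k) = 0 := by
  rcases (nearSet E z r 0).eq_empty_or_nonempty with h0 | ⟨x, hx⟩
  · exact measure_mono_null (iInter_subset _ 0) (by rw [h0]; exact measure_empty)
  have h_int := setLIntegral_distWeight_dyadicCell_le hr hE hA hx
  rw [dyadicCell_zero hr hx.1] at h_int
  have hfin : ∫⁻ y in CubeC z r, distWeight E γ y ≠ ∞ := by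
    refine ne_top_of_le_ne_top ?_ h_int
    refine ENNReal.mul_ne_top (ENNReal.mul_ne_top (ENNReal.mul_ne_top (ENNReal.mul_ne_top hC ?_)
      (by simp)) ?_) (volume_cubeC_ne_top z r)
    · exact ENNReal.rpow_ne_top_of_ne_zero (by simp) (by simp)
    · exact ENNReal.rpow_ne_top_of_ne_zero (dyadicSize_ne_zero hr 0) (dyadicSize_ne_top r 0)
  have hae := ae_lt_top measurable_distWeight hfin
  rw [ae_restrict_iff' (measurableSet_cubeC z r)] at hae
  refine measure_mono_null (fun y hy => ?_) hae
  simp only [mem_compl_iff, mem_ofPred_eq, not_forall]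
  rw [mem_iInter] at hy
  refine ⟨nearSet_subset 0 (hy 0), fun hlt => ?_⟩
  have hsum := tsum_indicator_nearSet_le (E := E) (z := z) hr hγ y
  have htop : ∑' k, (nearSet E z r k).indicator (fun _ => dyadicSize r k ^ γ) y = ∞ := by
    refine top_unique ?_
    rw [← ENNReal.tsum_const_eq_top_of_ne_zero (α := ℕ) (c := dyadicSize r 0 ^ γ)]
    · refine ENNReal.tsum_le_tsum fun k => ?_
      rw [indicator_of_mem (hy k)]
      refine ENNReal.rpow_le_rpow_of_nonpos hγ.le (ENNReal.ofReal_le_ofReal ?_)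
      gcongr
      · norm_num
      · exact k.zero_le
    · rw [ne_eq, ENNReal.rpow_eq_zero_iff]
      rintro (⟨-, h⟩ | ⟨h, -⟩)
      · linarith
      · exact dyadicSize_ne_top r 0 h
  rw [htop, top_le_iff] at hsum
  exact ENNReal.mul_ne_top (nearConst_ne_top n hγ) hlt.ne hsum

lemma setLIntegral_mul_distWeight_le (hr : 0 < r) (hγ : γ < 0) (hE : E.Nonempty)
    (hA : AikawaCondition E γ C) (hC : C ≠ ∞) {f : Rn n → ℝ≥0∞} (hf : Measurable f) :
    ∫⁻ x in CubeC z r, f x * distWeight E γ x ≤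
      ∑' k, dyadicSize r k ^ γ * ∫⁻ x in dyadicShell E z r k, f x := by
  calc ∫⁻ x in CubeC z r, f x * distWeight E γ x
      ≤ ∫⁻ x in (⋃ k, dyadicShell E z r k) ∪ ⋂ k, nearSet E z r k, f x * distWeight E γ x :=
        lintegral_mono_set subset_iUnion_dyadicShell
    _ ≤ ∫⁻ x in ⋃ k, dyadicShell E z r k, f x * distWeight E γ x := by
        refine (lintegral_union_le _ _ _).trans ?_
        rw [setLIntegral_measure_zero _ _ (volume_iInter_nearSet hr hγ hE hA hC), add_zero]
    _ ≤ ∑' k, ∫⁻ x in dyadicShell E z r k, f x * distWeight E γ x := lintegral_iUnion_le _ _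
    _ ≤ _ := by
        refine ENNReal.tsum_le_tsum fun k => ?_
        rw [← lintegral_const_mul _ hf]
        refine setLIntegral_mono' (measurableSet_dyadicShell hr k) fun x hx => ?_
        rw [mul_comm]
        gcongr
        have := dyadicShell_subset k hx
        exact distWeight_le_of_notMem_nearSet hγ.le this.1 this.2

end Shells

section WeightedPoincare

variable {n : ℕ} {z : Rn n} {r : ℝ} {E : Set (Rn n)} {γ : ℝ} {C : ℝ≥0∞}

lemma ENNReal.rpow_div_sub_one_mul_self {p q : ℝ} (hp : 0 < p) (hpq : p ≤ q) (S : ℝ≥0∞) :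
    S ^ (q / p - 1) * S = S ^ (q / p) := by
  have hqp : 0 ≤ q / p - 1 := by rw [sub_nonneg, le_div_iff₀ hp]; linarith
  nth_rewrite 2 [← ENNReal.rpow_one S]
  rw [← ENNReal.rpow_add_of_nonneg _ _ hqp zero_le_one, sub_add_cancel]

lemma measurable_setAverage_dyadicCell (u : Rn n → ℝ) (k : ℕ) :
    Measurable fun x => ⨍ y in dyadicCell z r k x, u y :=
  measurable_of_forall_mem_dyadicCell (z := z) (r := r) k fun x y hy => by
    simp only [dyadicCell_congr hy]

/-- Summing a Poincaré inequality over the Whitney-type cubes of the shells. -/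
lemma tsum_setLIntegral_dyadicShell_le (hr : 0 < r) {p q : ℝ} (hp : 1 < p) (hpq : p ≤ q)
    {u : Rn n → ℝ} {K : ℝ≥0∞}
    (hK : ∀ (v : Rn n) (s : ℝ), 0 < s →
      ENNReal.ofReal s ^ γ * ∫⁻ x in CubeC v s, ‖u x - ⨍ y in CubeC v s, u y‖ₑ ^ q ≤
        K * (∫⁻ x in CubeC v s, upperGradient u x ^ p) ^ (q / p)) (hu : Measurable u) :
    ∑' k, dyadicSize r k ^ γ *
        ∫⁻ x in dyadicShell E z r k, ‖u x - ⨍ y in dyadicCell z r k x, u y‖ₑ ^ q ≤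
      K * (∫⁻ x in CubeC z r, upperGradient u x ^ p) ^ (q / p) := by
  have hp0 : 0 < p := by linarith
  have hqp : 0 ≤ q / p - 1 := by rw [sub_nonneg, le_div_iff₀ hp0]; linarith
  set S := ∫⁻ x in CubeC z r, upperGradient u x ^ p with hS
  have hGm : Measurable fun x => upperGradient u x ^ p := (measurable_upperGradient u).pow_const p
  have hshell : ∀ k, dyadicSize r k ^ γ *
        ∫⁻ x in dyadicShell E z r k, ‖u x - ⨍ y in dyadicCell z r k x, u y‖ₑ ^ q ≤
      K * S ^ (q / p - 1) * ∫⁻ x in dyadicShell E z r k, upperGradient u x ^ p := by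
    intro k
    have hfm : Measurable fun x => ‖u x - ⨍ y in dyadicCell z r k x, u y‖ₑ ^ q :=
      (hu.sub (measurable_setAverage_dyadicCell u k)).enorm.pow_const q
    rw [← lintegral_const_mul _ hfm, ← lintegral_const_mul _ hGm]
    refine setLIntegral_le_of_dyadicCell k (fun x hx => dyadicCell_subset_dyadicShell hr hx) ?_
    intro x hx
    rw [lintegral_const_mul _ hfm, lintegral_const_mul _ hGm]
    set D := dyadicCell z r k x with hD
    have hcongr : ∫⁻ y in D, ‖u y - ⨍ y in dyadicCell z r k y, u y‖ₑ ^ q =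
        ∫⁻ y in D, ‖u y - ⨍ y in D, u y‖ₑ ^ q :=
      setLIntegral_congr_fun (measurableSet_dyadicCell k x) fun y hy => by
        simp only [dyadicCell_congr hy, hD]
    have hcell : dyadicSize r k ^ γ * ∫⁻ y in D, ‖u y - ⨍ y in D, u y‖ₑ ^ q ≤
        K * (∫⁻ y in D, upperGradient u y ^ p) ^ (q / p) := by
      rw [hD, dyadicCell_eq_cubeC hr]
      exact hK _ _ (by positivity)
    rw [hcongr]
    refine hcell.trans ?_
    rw [mul_assoc K, ← ENNReal.rpow_div_sub_one_mul_self hp0 hpq]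
    have hle : ∫⁻ y in D, upperGradient u y ^ p ≤ S :=
      lintegral_mono_set (dyadicCell_subset_cubeC hr k (dyadicShell_subset k hx).1)
    gcongr
  calc _ ≤ ∑' k, K * S ^ (q / p - 1) * ∫⁻ x in dyadicShell E z r k, upperGradient u x ^ p :=
        ENNReal.tsum_le_tsum hshell
    _ = K * S ^ (q / p - 1) * ∫⁻ x in ⋃ k, dyadicShell E z r k, upperGradient u x ^ p := by
        rw [ENNReal.tsum_mul_left, lintegral_iUnion (measurableSet_dyadicShell hr)
          (pairwise_disjoint_dyadicShell hr)]
    _ ≤ K * S ^ (q / p - 1) * S := by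
        refine mul_le_mul_right (lintegral_mono_set ?_) _
        exact iUnion_subset fun k => (dyadicShell_subset k).trans sdiff_subset
    _ = _ := by rw [mul_assoc, ENNReal.rpow_div_sub_one_mul_self hp0 hpq]

/-- A discrete Hardy inequality for functions constant on dyadic cubes, summed over the shells. -/
lemma exists_tsum_setLIntegral_dyadicShell_sum_le (n : ℕ) {q : ℝ} (hq : 1 < q) (hγ : γ < 0)
    (hC : C ≠ ∞) :
    ∃ K : ℝ≥0∞, K ≠ ∞ ∧ ∀ (E : Set (Rn n)), E.Nonempty → AikawaCondition E γ C →
      ∀ (z : Rn n) (r : ℝ), 0 < r → ∀ b : ℕ → Rn n → ℝ≥0∞,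
      (∀ j x, ∀ y ∈ dyadicCell z r j x, b j y = b j x) →
      ∑' k, dyadicSize r k ^ γ *
          ∫⁻ x in dyadicShell E z r k, (∑ j ∈ Finset.range k, b j x) ^ q ≤
        K * ∑' j, dyadicSize r j ^ γ * ∫⁻ x in nearSet E z r j, b j x ^ q := by
  have hq1 : 0 < q - 1 := by linarith
  set A : ℝ≥0∞ := nearConst n γ * (C * 4 ^ γ * 4 ^ n) + 2 with hA
  have hA1 : 1 < A := lt_of_lt_of_le (by norm_num) le_add_self
  have hAt : A ≠ ∞ := by
    refine ENNReal.add_ne_top.2 ⟨ENNReal.mul_ne_top (nearConst_ne_top n hγ) ?_, by simp⟩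
    refine ENNReal.mul_ne_top (ENNReal.mul_ne_top hC ?_) (by simp)
    exact ENNReal.rpow_ne_top_of_ne_zero (by simp) (by simp)
  set θ : ℝ≥0∞ := 1 - A⁻¹ with hθ
  have hθ0 : θ ≠ 0 := by simpa [hθ, tsub_eq_zero_iff_le] using hA1
  have hθ1 : θ < 1 := ENNReal.sub_lt_self (by simp) (by simp) (by simpa using hAt)
  have hθt : θ ≠ ∞ := hθ1.ne_top
  set τ : ℝ≥0∞ := θ ^ (1 / (2 * (q - 1))) with hτ
  have hτ0 : τ ≠ 0 := by simp [hτ, ENNReal.rpow_eq_zero_iff, hθ0, hθt]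
  have hτ1 : τ < 1 := ENNReal.rpow_lt_one hθ1 (by positivity)
  set σ : ℝ≥0∞ := θ ^ (1 / 2 : ℝ) with hσ
  have hσ1 : σ < 1 := ENNReal.rpow_lt_one hθ1 (by positivity)
  have hτσ : ∀ l : ℕ, (τ ^ l) ^ (1 - q) * θ ^ l = σ ^ l := by
    intro l
    rw [hτ, hσ, ← ENNReal.rpow_natCast, ← ENNReal.rpow_natCast, ← ENNReal.rpow_natCast,
      ← ENNReal.rpow_mul, ← ENNReal.rpow_mul, ← ENNReal.rpow_mul, ← ENNReal.rpow_add _ _ hθ0 hθt]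
    congr 1
    field_simp; ring
  set W : ℝ≥0∞ := (1 - τ)⁻¹ ^ (q - 1) with hW
  refine ⟨2 ^ (-γ) * W * (A * (1 - σ)⁻¹), ?_, ?_⟩
  · refine ENNReal.mul_ne_top (ENNReal.mul_ne_top ?_ ?_) (ENNReal.mul_ne_top hAt ?_)
    · exact ENNReal.rpow_ne_top_of_ne_zero (by simp) (by simp)
    · refine ENNReal.rpow_ne_top_of_nonneg hq1.le ?_
      simpa [tsub_eq_zero_iff_le] using hτ1
    · simpa [tsub_eq_zero_iff_le] using hσ1
  intro E hE hAE z r hr b hb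
  have hbm : ∀ j, Measurable fun x => b j x ^ q := fun j =>
    (measurable_of_forall_mem_dyadicCell j (hb j)).pow_const q
  set X : ℕ → ℝ≥0∞ := fun j => dyadicSize r j ^ γ * ∫⁻ x in nearSet E z r j, b j x ^ q with hX
  have hterm : ∀ k, dyadicSize r (k + 1) ^ γ *
      ∫⁻ x in dyadicShell E z r (k + 1), (∑ j ∈ Finset.range (k + 1), b j x) ^ q ≤
      ∑ j ∈ Finset.range (k + 1), 2 ^ (-γ) * W * (A * σ ^ (k - j) * X j) := by
    intro k
    have hsize : dyadicSize r (k + 1) ^ γ = 2 ^ (-γ) * dyadicSize r k ^ γ := by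
      rw [dyadicSize_eq_two_mul r k, ENNReal.mul_rpow_of_ne_top (by simp) (dyadicSize_ne_top r _),
        ← mul_assoc, ← ENNReal.rpow_add _ _ (by simp) (by simp), neg_add_cancel,
        ENNReal.rpow_zero, one_mul]
    have hdecay : ∀ j ∈ Finset.range (k + 1),
        dyadicSize r k ^ γ * ∫⁻ x in nearSet E z r k, b j x ^ q ≤ A * θ ^ (k - j) * X j := by
      intro j hj
      have hjk : j + (k - j) = k := by
        have := Finset.mem_range.1 hj
        omega
      have := setLIntegral_nearSet_decay hr hγ hE hAE hC (z := z) (j := j) (H := fun x => b j x ^ q)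
        (fun x y hy => by simp only [hb j x y hy]) hA (k - j)
      rwa [hjk] at this
    calc _ ≤ 2 ^ (-γ) * dyadicSize r k ^ γ * ∫⁻ x in nearSet E z r k,
          W * ∑ j ∈ Finset.range (k + 1), b j x ^ q * (τ ^ (k - j)) ^ (1 - q) := by
          rw [hsize]
          refine mul_le_mul_right ?_ _
          refine (lintegral_mono_set sdiff_subset).trans (lintegral_mono fun x => ?_)
          exact ENNReal.sum_rpow_le_geometric hq.le hτ0 hτ1.ne_top (fun j => b j x) k
      _ = ∑ j ∈ Finset.range (k + 1), 2 ^ (-γ) * W * ((τ ^ (k - j)) ^ (1 - q) *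
          (dyadicSize r k ^ γ * ∫⁻ x in nearSet E z r k, b j x ^ q)) := by
          rw [lintegral_const_mul _ (Finset.measurable_sum _ fun j _ => (hbm j).mul_const _),
            lintegral_finsetSum _ fun j _ => (hbm j).mul_const _, Finset.mul_sum, Finset.mul_sum]
          refine Finset.sum_congr rfl fun j _ => ?_
          rw [lintegral_mul_const _ (hbm j)]
          ring
      _ ≤ _ := by
          refine Finset.sum_le_sum fun j hj => ?_
          refine mul_le_mul_right ((mul_le_mul_right (hdecay j hj) _).trans_eq ?_) _
          rw [← hτσ]; ring
  rw [tsum_eq_zero_add' ENNReal.summable]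
  simp only [Finset.range_zero, Finset.sum_empty]
  rw [ENNReal.zero_rpow_of_pos (by linarith), lintegral_zero, mul_zero, zero_add]
  refine (ENNReal.tsum_le_tsum hterm).trans_eq ?_
  rw [ENNReal.tsum_sum_range_succ_eq fun j l => 2 ^ (-γ) * W * (A * σ ^ l * X j)]
  have : ∀ j, ∑' l, 2 ^ (-γ) * W * (A * σ ^ l * X j) =
      2 ^ (-γ) * W * (A * (1 - σ)⁻¹) * X j := by
    intro j
    rw [ENNReal.tsum_mul_left, ENNReal.tsum_mul_right, ENNReal.tsum_mul_left,
      ENNReal.tsum_geometric]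
    ring
  simp only [this]
  rw [ENNReal.tsum_mul_left]

/-- The weighted Poincaré inequality below the Sobolev exponent, for globally Lipschitz
functions. -/
theorem exists_weighted_poincare_of_neg (n : ℕ) {p q : ℝ} (hp : 1 < p) (hpq : p ≤ q) (hpn : p < n)
    (hq : q ≤ n * p / (n - p)) (hγ : -(n : ℝ) + q / p * (n - p) < 0) (hC : C ≠ ∞) :
    ∃ K : ℝ≥0∞, K ≠ ∞ ∧ ∀ (E : Set (Rn n)), E.Nonempty →
      AikawaCondition E (-(n : ℝ) + q / p * (n - p)) C →
      ∀ (z : Rn n) (r : ℝ), 0 < r → ∀ (u : Rn n → ℝ) (L : ℝ≥0), LipschitzWith L u →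
      ∫⁻ x in CubeC z r, ‖u x - ⨍ y in CubeC z r, u y‖ₑ ^ q *
          distWeight E (-(n : ℝ) + q / p * (n - p)) x ≤
        K * (∫⁻ x in CubeC z r, upperGradient u x ^ p) ^ (q / p) := by
  have hp0 : 0 < p := by linarith
  obtain ⟨K₀, hK₀, hPoinc⟩ := exists_poincare_cubeC_of_le n hp hpq hpn hq
  obtain ⟨K₁, hK₁, hHardy⟩ :=
    exists_tsum_setLIntegral_dyadicShell_sum_le n (q := q) (by linarith) hγ hC
  have hβ : (-(n : ℝ) + q / p * (n - p)) * (p - 1) < 0 := mul_neg_of_neg_of_pos hγ (by linarith)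
  set γ := -(n : ℝ) + q / p * (n - p) with hγdef
  set K₂ : ℝ≥0∞ := (C * 4 ^ γ * 4 ^ n) ^ (p - 1) * nearConst n (γ * (p - 1)) with hK₂
  have hK₂t : K₂ ≠ ∞ := by
    refine ENNReal.mul_ne_top (ENNReal.rpow_ne_top_of_nonneg (by linarith) ?_)
      (nearConst_ne_top n hβ)
    refine ENNReal.mul_ne_top (ENNReal.mul_ne_top hC ?_) (by simp)
    exact ENNReal.rpow_ne_top_of_ne_zero (by simp) (by simp)
  refine ⟨2 ^ (q - 1) * (K₀ + chainConst n ^ q * (K₁ * K₂)), ?_, ?_⟩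
  · refine ENNReal.mul_ne_top (ENNReal.rpow_ne_top_of_nonneg (by linarith) (by simp)) ?_
    refine ENNReal.add_ne_top.2 ⟨hK₀, ENNReal.mul_ne_top ?_ (ENNReal.mul_ne_top hK₁ hK₂t)⟩
    refine ENNReal.rpow_ne_top_of_nonneg (by linarith) ?_
    exact ENNReal.mul_ne_top (ENNReal.mul_ne_top (by simp) (by simp)) ENNReal.ofReal_ne_top
  intro E hE hA z r hr u L hu
  have hum := hu.continuous.measurable
  have hGm := measurable_upperGradient u
  set S := ∫⁻ x in CubeC z r, upperGradient u x ^ p with hS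
  set b : ℕ → Rn n → ℝ≥0∞ := fun j x =>
    dyadicSize r j * dyadicAverage z r j (upperGradient u) x with hb
  have hbm : ∀ j, Measurable (b j) := fun j => (measurable_dyadicAverage j _).const_mul _
  have hlocal := tsum_setLIntegral_dyadicShell_le (E := E) (z := z) hr hp hpq
    (hPoinc u L hu) hum
  have hchain := hHardy E hE hA z r hr b fun j x y hy => by
    simp only [hb, dyadicAverage_congr hy]
  have hCarleson : ∑' j, dyadicSize r j ^ γ * ∫⁻ x in nearSet E z r j, b j x ^ q ≤
      K₂ * S ^ (q / p) := by
    calc _ ≤ ∑' j, S ^ (q / p - 1) *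
          ∫⁻ x in nearSet E z r j, dyadicAverage z r j (upperGradient u) x ^ p := by
          refine ENNReal.tsum_le_tsum fun j => ?_
          rw [← lintegral_const_mul _ ((hbm j).pow_const q),
            ← lintegral_const_mul _ ((measurable_dyadicAverage j _).pow_const p)]
          refine setLIntegral_mono' (measurableSet_nearSet hr j) fun x hx => ?_
          exact dyadicSize_rpow_mul_dyadicAverage_rpow_le hr hp hpq hGm j (nearSet_subset j hx)
      _ ≤ S ^ (q / p - 1) * (K₂ * S) := by
          rw [ENNReal.tsum_mul_left]
          gcongr
          exact tsum_setLIntegral_dyadicAverage_rpow_le hr hγ hE hA hC hp hGm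
      _ = _ := by rw [← ENNReal.rpow_div_sub_one_mul_self hp0 hpq]; ring
  have hfm : ∀ k, Measurable fun x => ‖u x - ⨍ y in dyadicCell z r k x, u y‖ₑ ^ q := fun k =>
    (hum.sub (measurable_setAverage_dyadicCell u k)).enorm.pow_const q
  have hsm : ∀ k, Measurable fun x => (∑ j ∈ Finset.range k, b j x) ^ q := fun k =>
    (Finset.measurable_sum _ fun j _ => hbm j).pow_const q
  have hshell : ∀ k, dyadicSize r k ^ γ *
      ∫⁻ x in dyadicShell E z r k, ‖u x - ⨍ y in CubeC z r, u y‖ₑ ^ q ≤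
      2 ^ (q - 1) * ((dyadicSize r k ^ γ *
        ∫⁻ x in dyadicShell E z r k, ‖u x - ⨍ y in dyadicCell z r k x, u y‖ₑ ^ q) +
        chainConst n ^ q * (dyadicSize r k ^ γ *
          ∫⁻ x in dyadicShell E z r k, (∑ j ∈ Finset.range k, b j x) ^ q)) := by
    intro k
    calc _ ≤ dyadicSize r k ^ γ * ∫⁻ x in dyadicShell E z r k,
          2 ^ (q - 1) * (‖u x - ⨍ y in dyadicCell z r k x, u y‖ₑ ^ q +
            chainConst n ^ q * (∑ j ∈ Finset.range k, b j x) ^ q) := by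
          refine mul_le_mul_right ?_ _
          refine setLIntegral_mono' (measurableSet_dyadicShell hr k) fun x hx => ?_
          refine (ENNReal.rpow_le_rpow (hu.enorm_sub_average_cubeC_le hr k
            (dyadicShell_subset k hx).1) (by linarith)).trans ?_
          refine (ENNReal.rpow_add_le_mul_rpow_add_rpow _ _ (by linarith)).trans_eq ?_
          rw [ENNReal.mul_rpow_of_nonneg _ _ (by linarith)]
      _ = _ := by
          rw [lintegral_const_mul _ (by exact (hfm k).add ((hsm k).const_mul _)),
            lintegral_add_left (hfm k), lintegral_const_mul _ (hsm k)]
          ring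
  calc _ ≤ _ := setLIntegral_mul_distWeight_le hr hγ hE hA hC
          ((hum.sub measurable_const).enorm.pow_const q)
    _ ≤ _ := ENNReal.tsum_le_tsum hshell
    _ ≤ 2 ^ (q - 1) * (K₀ * S ^ (q / p) + chainConst n ^ q * (K₁ * (K₂ * S ^ (q / p)))) := by
        rw [ENNReal.tsum_mul_left, ENNReal.tsum_add, ENNReal.tsum_mul_left]
        gcongr
        exact hchain.trans (mul_le_mul_right hCarleson _)
    _ = _ := by ring

end WeightedPoincare

/-- The weighted Poincaré inequality for globally Lipschitz functions. -/
theorem exists_weighted_poincare (n : ℕ) {p q : ℝ} (hp : 1 < p) (hpq : p ≤ q) (hpn : p < n)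
    (hq : q ≤ n * p / (n - p)) {C : ℝ≥0∞} (hC : C ≠ ∞) :
    ∃ K : ℝ≥0∞, K ≠ ∞ ∧ ∀ (E : Set (Rn n)), E.Nonempty →
      AikawaCondition E (-(n : ℝ) + q / p * (n - p)) C →
      ∀ (z : Rn n) (r : ℝ), 0 < r → ∀ (u : Rn n → ℝ) (L : ℝ≥0), LipschitzWith L u →
      ∫⁻ x in CubeC z r, ‖u x - ⨍ y in CubeC z r, u y‖ₑ ^ q *
          distWeight E (-(n : ℝ) + q / p * (n - p)) x ≤
        K * (∫⁻ x in CubeC z r, upperGradient u x ^ p) ^ (q / p) := by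
  have hp0 : 0 < p := by linarith
  have hnp : 0 < (n : ℝ) - p := by linarith
  have hγ : -(n : ℝ) + q / p * (n - p) ≤ 0 := by
    have : q * (n - p) ≤ n * p := by rwa [le_div_iff₀ hnp] at hq
    have h : q / p * (n - p) ≤ n := by
      rw [div_mul_eq_mul_div, div_le_iff₀ hp0]; exact this
    linarith
  rcases hγ.lt_or_eq with hγ | hγ
  · exact exists_weighted_poincare_of_neg n hp hpq hpn hq hγ hC
  · obtain ⟨K, hK, h⟩ := exists_poincare_cubeC_of_le n hp hpq hpn hq
    refine ⟨K, hK, fun E _ _ z r hr u L hu => ?_⟩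
    have := h u L hu z r hr
    simpa only [hγ, distWeight, ENNReal.rpow_zero, mul_one, one_mul] using this

/-- The gradient of a function agreeing with a Lipschitz function on a cube. -/
lemma LipschitzWith.setLIntegral_upperGradient_eq {n : ℕ} {u v : Rn n → ℝ} {L : ℝ≥0}
    (hv : LipschitzWith L v) {z : Rn n} {r : ℝ} (huv : EqOn u v (CubeC z r)) (p : ℝ) :
    ∫⁻ x in CubeC z r, upperGradient v x ^ p =
      ∫⁻ x in CubeC z r, ENNReal.ofReal ‖fderiv ℝ u x‖ ^ p := by
  have hfr : ∀ᵐ x, x ∉ frontier (CubeC z r) :=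
    measure_eq_zero_iff_ae_notMem.1 ((convex_cubeC z r).addHaar_frontier volume)
  refine setLIntegral_congr_fun_ae (measurableSet_cubeC z r) ?_
  filter_upwards [hfr, hv.upperGradient_ae_eq] with x hx hG hxQ
  have h_int : x ∈ interior (CubeC z r) := by
    rw [← self_sdiff_frontier]
    exact ⟨hxQ, hx⟩
  have he : u =ᶠ[nhds x] v := Filter.eventuallyEq_of_mem (mem_interior_iff_mem_nhds.1 h_int) huv
  rw [hG, he.fderiv_eq, ofReal_norm]

/-- distance-weight Poincaré inequality on a cube: let
`1 < p ≤ q ≤ np/(n−p) < ∞` and `γ = −n + (q/p)(n−p)`, and let `E ⊆ ℝ^n` be a nonempty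
closed set satisfying the Aikawa-type condition `⨍_{Q(z,r)} d(x,E)^γ dx ≤ C₁ r^γ` for every
`z ∈ E` and `r > 0`. Then there is `C = C(n, p, q, C₁) > 0` such that for every cube `Q` and
every Lipschitz `u` on `Q`,
`(∫_Q |u − u_Q|^q d(x,E)^γ dx)^{1/q} ≤ C (∫_Q |∇u|^p dx)^{1/p}`. -/
theorem distance_weight_poincare_on_cube
    (n : ℕ) (p q C₁ : ℝ) (hp : 1 < p) (hpq : p ≤ q) (hpn : p < n)
    (hq : q ≤ n * p / (n - p)) (hC₁ : 0 < C₁) :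
    ∃ C : ℝ, 0 < C ∧
      ∀ E : Set (Rn n), E.Nonempty → IsClosed E →
      (∀ z ∈ E, ∀ r : ℝ, 0 < r →
        (∫⁻ x in CubeC z r, distWeight E (-(n : ℝ) + q / p * (n - p)) x) ≤
          ENNReal.ofReal C₁ * ENNReal.ofReal (r ^ (-(n : ℝ) + q / p * (n - p))) *
            volume (CubeC z r)) →
      ∀ (z : Rn n) (r : ℝ), 0 < r →
      ∀ (u : Rn n → ℝ) (L : ℝ≥0), LipschitzOnWith L u (CubeC z r) →
        (∫⁻ x in CubeC z r,
            (ENNReal.ofReal |u x - ⨍ y in CubeC z r, u y|) ^ q *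
              distWeight E (-(n : ℝ) + q / p * (n - p)) x) ^ (1 / q) ≤
          ENNReal.ofReal C *
            (∫⁻ x in CubeC z r, (ENNReal.ofReal ‖fderiv ℝ u x‖) ^ p) ^ (1 / p) := by
  obtain ⟨K, hK, h⟩ := exists_weighted_poincare n hp hpq hpn hq (C := ENNReal.ofReal C₁)
    ENNReal.ofReal_ne_top
  have hp0 : 0 < p := by linarith
  have hq0 : 0 < q := by linarith
  have hKq : K ^ (1 / q) ≠ ∞ := ENNReal.rpow_ne_top_of_nonneg (by positivity) hK
  refine ⟨(K ^ (1 / q)).toReal + 1, by positivity, ?_⟩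
  intro E hE _ hA z r hr u L hu
  obtain ⟨v, hv, huv⟩ := hu.extend_real
  have hAE : AikawaCondition E (-(n : ℝ) + q / p * (n - p)) (ENNReal.ofReal C₁) := by
    intro e he s hs
    rw [ENNReal.ofReal_rpow_of_pos hs]
    exact hA e he s hs
  have havg : ⨍ y in CubeC z r, u y = ⨍ y in CubeC z r, v y :=
    setAverage_congr_fun (measurableSet_cubeC z r) (.of_forall huv)
  have hlhs : ∫⁻ x in CubeC z r, (ENNReal.ofReal |u x - ⨍ y in CubeC z r, u y|) ^ q *
        distWeight E (-(n : ℝ) + q / p * (n - p)) x =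
      ∫⁻ x in CubeC z r, ‖v x - ⨍ y in CubeC z r, v y‖ₑ ^ q *
        distWeight E (-(n : ℝ) + q / p * (n - p)) x := by
    refine setLIntegral_congr_fun (measurableSet_cubeC z r) fun x hx => ?_
    rw [havg, huv hx, ← Real.norm_eq_abs, ofReal_norm]
  rw [hlhs, ← hv.setLIntegral_upperGradient_eq huv p]
  calc _ ≤ (K * (∫⁻ x in CubeC z r, upperGradient v x ^ p) ^ (q / p)) ^ (1 / q) :=
        ENNReal.rpow_le_rpow (h E hE hAE z r hr v L hv) (by positivity)
    _ = K ^ (1 / q) * (∫⁻ x in CubeC z r, upperGradient v x ^ p) ^ (1 / p) := by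
        rw [ENNReal.mul_rpow_of_nonneg _ _ (by positivity), ← ENNReal.rpow_mul,
          show q / p * (1 / q) = 1 / p by field_simp]
    _ ≤ _ := by
        gcongr
        rw [ENNReal.ofReal_add ENNReal.toReal_nonneg zero_le_one, ENNReal.ofReal_toReal hKq]
        exact le_self_add
end
end
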